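/- arXiv:1310.7771 — 8 statements merged into one kernel-verified Lean document; each statement's English description precedes it below -/
import Mathlib

section
/- For every p ∈ [1, ∞) there exists a constant C_p > 0 such that every nonnegative, continuously differentiable function f on ℝ² with finite mass M := ∫_{ℝ²} f dx and finite Fisher information I(f) satisfies ‖f‖_{L^p(ℝ²)} ≤ C_p · M^{1/p} · I(f)^{1 − 1/p}. -/
open MeasureTheory Real

noncomputable section

open scoped ENNReal NNReal Topology
open Filter

abbrev E2 := EuclideanSpace ℝ (Fin 2)

/-- The `L²`-`L¹` Sobolev inequality for integrable `C¹` functions. -/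
lemma sobolev_integrable : ∃ K : ℝ≥0, ∀ u : E2 → ℝ, ContDiff ℝ 1 u → (∫⁻ x, ‖u x‖ₑ) ≠ ∞ →
    ∫⁻ x, ‖u x‖ₑ ^ (2 : ℝ) ≤ K * (∫⁻ x, ‖fderiv ℝ u x‖ₑ) ^ (2 : ℝ) := by
  refine ⟨lintegralPowLePowLIntegralFDerivConst (volume : Measure E2) 2, fun u hu hfin => ?_⟩
  set K := lintegralPowLePowLIntegralFDerivConst (volume : Measure E2) 2
  let b : ContDiffBump (0 : E2) := ⟨1, 2, by norm_num, by norm_num⟩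
  have hb : ContDiff ℝ 1 b := b.contDiff
  have hbc : HasCompactSupport b := b.hasCompactSupport
  obtain ⟨L, hL⟩ : ∃ L, ∀ x, ‖fderiv ℝ b x‖ ≤ L :=
    (hb.continuous_fderiv one_ne_zero).bounded_above_of_compact_support (hbc.fderiv ℝ)
  have hL0 : 0 ≤ L := (norm_nonneg _).trans (hL 0)
  let c : ℕ → ℝ := fun n => 1 / ((n : ℝ) + 1)
  have hc : ∀ n, 0 < c n := fun n => by positivity
  have hc0 : Tendsto c atTop (𝓝 0) := tendsto_one_div_add_atTop_nhds_zero_nat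
  let v : ℕ → E2 → ℝ := fun n x => b (c n • x) * u x
  have hsc : ∀ n, ContDiff ℝ 1 (fun x : E2 => b (c n • x)) := fun n =>
    hb.comp (contDiff_const_smul (c n))
  have hv : ∀ n, ContDiff ℝ 1 (v n) := fun n => (hsc n).mul hu
  have hvc : ∀ n, HasCompactSupport (v n) := fun n =>
    (hbc.comp_smul (hc n).ne').mul_right
  have hd : ∀ n x, ‖fderiv ℝ (v n) x‖ₑ ≤ ‖fderiv ℝ u x‖ₑ + ENNReal.ofReal (c n * L) * ‖u x‖ₑ := by
    intro n x
    have h1 : HasFDerivAt (fun x : E2 => b (c n • x)) (c n • fderiv ℝ b (c n • x)) x := by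
      have := (hb.differentiable one_ne_zero (c n • x)).hasFDerivAt.comp x
        ((hasFDerivAt_id x).const_smul (c n))
      convert! this using 1
      ext y
      simp
    have h2 := h1.mul (hu.differentiable one_ne_zero x).hasFDerivAt
    have h3 : ‖fderiv ℝ (v n) x‖ ≤ ‖fderiv ℝ u x‖ + (c n * L) * ‖u x‖ := by
      rw [show fderiv ℝ (v n) x = _ from h2.fderiv]
      refine (norm_add_le _ _).trans ?_
      rw [norm_smul, norm_smul, norm_smul]
      have e1 : ‖b (c n • x)‖ ≤ 1 := by
        rw [Real.norm_of_nonneg b.nonneg]; exact b.le_one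
      have e2 := hL (c n • x)
      rw [Real.norm_of_nonneg (hc n).le]
      have e3 : ‖b (c n • x)‖ * ‖fderiv ℝ u x‖ ≤ 1 * ‖fderiv ℝ u x‖ := by gcongr
      have e4 : ‖u x‖ * (c n * ‖fderiv ℝ b (c n • x)‖) ≤ ‖u x‖ * (c n * L) := by
        have := (hc n).le
        gcongr
      linarith
    rw [← ofReal_norm, ← ofReal_norm, ← ofReal_norm, ← ENNReal.ofReal_mul (by have := hc n; positivity),
      ← ENNReal.ofReal_add (by positivity) (by have := hc n; positivity)]
    exact ENNReal.ofReal_le_ofReal h3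
  have hconj : Real.HolderConjugate (Module.finrank ℝ E2) 2 := by
    rw [finrank_euclideanSpace_fin]
    rw [Real.holderConjugate_iff]; norm_num
  have hmain : ∀ n, ∫⁻ x, ‖v n x‖ₑ ^ (2 : ℝ) ≤
      K * ((∫⁻ x, ‖fderiv ℝ u x‖ₑ) + ENNReal.ofReal (c n * L) * ∫⁻ x, ‖u x‖ₑ) ^ (2 : ℝ) := by
    intro n
    refine (lintegral_pow_le_pow_lintegral_fderiv volume (hv n) (hvc n) hconj).trans ?_
    gcongr
    rw [← lintegral_const_mul _ (by have := hu.continuous; fun_prop), ← lintegral_add_left]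
    · exact lintegral_mono (hd n)
    · have := hu.continuous_fderiv one_ne_zero
      fun_prop
  have hlim : ∀ x, Tendsto (fun n => ‖v n x‖ₑ ^ (2 : ℝ)) atTop (𝓝 (‖u x‖ₑ ^ (2 : ℝ))) := by
    intro x
    have h1 : Tendsto (fun n => c n • x) atTop (𝓝 0) := by
      simpa using hc0.smul_const x
    have h2 : Tendsto (fun n => v n x) atTop (𝓝 (u x)) := by
      have h3 := ((hb.continuous.tendsto 0).comp h1).mul_const (u x)
      have h4 : b 0 = 1 := b.one_of_mem_closedBall (by simp [b])
      rw [h4, one_mul] at h3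
      exact h3
    exact ((ENNReal.continuous_rpow_const.tendsto _).comp ((continuous_enorm.tendsto _).comp h2))
  have hR : Tendsto (fun n => (K : ℝ≥0∞) * ((∫⁻ x, ‖fderiv ℝ u x‖ₑ) +
      ENNReal.ofReal (c n * L) * ∫⁻ x, ‖u x‖ₑ) ^ (2 : ℝ)) atTop
      (𝓝 (K * (∫⁻ x, ‖fderiv ℝ u x‖ₑ) ^ (2 : ℝ))) := by
    refine ENNReal.Tendsto.const_mul ?_ (Or.inr ENNReal.coe_ne_top)
    refine (ENNReal.continuous_rpow_const.tendsto _).comp ?_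
    have h1 : Tendsto (fun n => ENNReal.ofReal (c n * L)) atTop (𝓝 0) := by
      have := ENNReal.tendsto_ofReal (hc0.mul_const L)
      simpa using this
    have h2 := ENNReal.Tendsto.mul_const h1 (b := ∫⁻ x, ‖u x‖ₑ) (Or.inr hfin)
    have h3 := (tendsto_const_nhds (x := ∫⁻ x, ‖fderiv ℝ u x‖ₑ)).add h2
    simpa using h3
  calc ∫⁻ x, ‖u x‖ₑ ^ (2 : ℝ) = ∫⁻ x, liminf (fun n => ‖v n x‖ₑ ^ (2 : ℝ)) atTop := by
        congr 1; ext x; exact (hlim x).liminf_eq.symm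
    _ ≤ liminf (fun n => ∫⁻ x, ‖v n x‖ₑ ^ (2 : ℝ)) atTop := by
        refine lintegral_liminf_le fun n => ?_
        have := (hv n).continuous
        fun_prop
    _ ≤ liminf (fun n => (K : ℝ≥0∞) * ((∫⁻ x, ‖fderiv ℝ u x‖ₑ) +
      ENNReal.ofReal (c n * L) * ∫⁻ x, ‖u x‖ₑ) ^ (2 : ℝ)) atTop :=
        liminf_le_liminf (Eventually.of_forall hmain)
    _ = _ := hR.liminf_eq

lemma step : ∃ K : ℝ≥0, ∀ f : E2 → ℝ, (∀ x, 0 ≤ f x) → ContDiff ℝ 1 f → ∀ q : ℝ, 1 ≤ q →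
    (∫⁻ x, ‖f x‖ₑ ^ q) ≠ ∞ →
    ∫⁻ x, ‖f x‖ₑ ^ (2 * q) ≤ K * ENNReal.ofReal q ^ (2 : ℝ) *
      (∫⁻ x, ‖f x‖ₑ ^ (2 * q - 1)) * ∫⁻ x, ENNReal.ofReal (‖gradient f x‖ ^ 2 / f x) := by
  obtain ⟨K, hK⟩ := sobolev_integrable
  refine ⟨K, fun f hf0 hf q hq hfin => ?_⟩
  have hq0 : 0 ≤ q := by linarith
  have hen : ∀ s : ℝ, 0 ≤ s → ∀ x, ‖f x ^ s‖ₑ = ‖f x‖ₑ ^ s := by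
    intro s hs x
    rw [Real.enorm_of_nonneg (Real.rpow_nonneg (hf0 x) _), Real.enorm_of_nonneg (hf0 x),
      ENNReal.ofReal_rpow_of_nonneg (hf0 x) hs]
  have hu : ContDiff ℝ 1 (fun x => f x ^ q) :=
    hf.rpow_const_of_le (by exact_mod_cast hq)
  have h1 := hK _ hu (by simpa [hen q hq0] using hfin)
  simp only [hen q hq0, ← ENNReal.rpow_mul] at h1
  rw [mul_comm q 2] at h1
  refine h1.trans ?_
  rw [mul_assoc, mul_assoc]
  gcongr
  have hgrad : ∀ x, ‖gradient f x‖ = ‖fderiv ℝ f x‖ := fun x => by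
    simp [gradient]
  have hdf : Continuous (fderiv ℝ f) := hf.continuous_fderiv one_ne_zero
  have hpt : ∀ x, ‖fderiv ℝ (fun x => f x ^ q) x‖ₑ ≤ ENNReal.ofReal q *
      ((‖f x‖ₑ ^ (2 * q - 1)) ^ (1 / 2 : ℝ) *
        (ENNReal.ofReal (‖gradient f x‖ ^ 2 / f x)) ^ (1 / 2 : ℝ)) := by
    intro x
    have hd := (hf.differentiable one_ne_zero x).hasFDerivAt.rpow_const (p := q) (Or.inr hq)
    rw [hd.fderiv, ← hen _ (by linarith), Real.enorm_of_nonneg (Real.rpow_nonneg (hf0 x) _),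
      ENNReal.ofReal_rpow_of_nonneg (Real.rpow_nonneg (hf0 x) _) (by norm_num),
      ENNReal.ofReal_rpow_of_nonneg (div_nonneg (by positivity) (hf0 x)) (by norm_num),
      ← ENNReal.ofReal_mul (by have := hf0 x; positivity), ← ENNReal.ofReal_mul hq0, ← ofReal_norm]
    apply ENNReal.ofReal_le_ofReal
    rw [hgrad, norm_smul, Real.norm_of_nonneg (mul_nonneg hq0 (Real.rpow_nonneg (hf0 x) _)), mul_assoc]
    apply mul_le_mul_of_nonneg_left _ hq0
    rcases (hf0 x).eq_or_lt with h | h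
    · have hmin : IsLocalMin f x := Eventually.of_forall fun y => by rw [← h]; exact hf0 y
      rw [hmin.fderiv_eq_zero]
      simp only [norm_zero, mul_zero]
      have := hf0 x
      positivity
    · rw [← Real.mul_rpow (by positivity) (by positivity), ← Real.sqrt_eq_rpow]
      apply Real.le_sqrt_of_sq_le
      rw [mul_pow, ← Real.rpow_natCast, ← Real.rpow_mul h.le]
      have : f x ^ (2 * q - 1) = f x ^ ((q - 1) * (2:ℕ)) * f x := by
        rw [← Real.rpow_add_one h.ne']; congr 1; push_cast; ring
      rw [this]
      apply le_of_eq
      field_simp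
  have hmA : AEMeasurable (fun x => ‖f x‖ₑ ^ (2 * q - 1)) (volume : Measure E2) := by
    have := hf.continuous
    fun_prop
  have hmB : AEMeasurable (fun x => ENNReal.ofReal (‖gradient f x‖ ^ 2 / f x)) (volume : Measure E2) := by
    have := hf.continuous
    simp only [hgrad]
    have h1 : Measurable (fun x => ‖fderiv ℝ f x‖ ^ 2) := (hdf.norm.pow 2).measurable
    exact (h1.div this.measurable).ennreal_ofReal.aemeasurable
  have h2 : ∫⁻ x, ‖fderiv ℝ (fun x => f x ^ q) x‖ₑ ≤ ENNReal.ofReal q *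
      ((∫⁻ x, ‖f x‖ₑ ^ (2 * q - 1)) ^ (1 / 2 : ℝ) *
        (∫⁻ x, ENNReal.ofReal (‖gradient f x‖ ^ 2 / f x)) ^ (1 / 2 : ℝ)) := by
    refine (lintegral_mono hpt).trans ?_
    rw [lintegral_const_mul' _ _ ENNReal.ofReal_ne_top]
    gcongr
    exact ENNReal.lintegral_mul_norm_pow_le hmA hmB (by norm_num) (by norm_num) (by norm_num)
  refine (ENNReal.rpow_le_rpow h2 (by norm_num : (0:ℝ) ≤ 2)).trans ?_
  rw [ENNReal.mul_rpow_of_nonneg _ _ (by norm_num), ENNReal.mul_rpow_of_nonneg _ _ (by norm_num),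
    ← ENNReal.rpow_mul, ← ENNReal.rpow_mul]
  norm_num

lemma nat_bound (n : ℕ) : ∃ C : ℝ≥0, ∀ f : E2 → ℝ, (∀ x, 0 ≤ f x) → ContDiff ℝ 1 f →
    (∫⁻ x, ‖f x‖ₑ) ≠ ∞ → (∫⁻ x, ENNReal.ofReal (‖gradient f x‖ ^ 2 / f x)) ≠ ∞ →
    ∫⁻ x, ‖f x‖ₑ ^ ((n : ℝ) + 1) ≤ C *
      (∫⁻ x, ENNReal.ofReal (‖gradient f x‖ ^ 2 / f x)) ^ n * ∫⁻ x, ‖f x‖ₑ := by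
  induction n with
  | zero => exact ⟨1, fun f _ _ _ _ => by simp⟩
  | succ n ih =>
    obtain ⟨C, hC⟩ := ih
    obtain ⟨K, hK⟩ := step
    refine ⟨K * (((n : ℝ) + 2) / 2).toNNReal ^ (2 : ℝ) * C, fun f hf0 hf hM hI => ?_⟩
    have h1 := hC f hf0 hf hM hI
    set J := ∫⁻ x, ENNReal.ofReal (‖gradient f x‖ ^ 2 / f x)
    set M := ∫⁻ x, ‖f x‖ₑ
    have hn0 : (0 : ℝ) ≤ n := n.cast_nonneg
    have hAn : (∫⁻ x, ‖f x‖ₑ ^ ((n : ℝ) + 1)) ≠ ∞ := by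
      refine ne_top_of_le_ne_top ?_ h1
      exact ENNReal.mul_ne_top (ENNReal.mul_ne_top ENNReal.coe_ne_top (ENNReal.pow_ne_top hI)) hM
    have hfin : (∫⁻ x, ‖f x‖ₑ ^ (((n : ℝ) + 2) / 2)) ≠ ∞ := by
      rcases Nat.eq_zero_or_pos n with h | h
      · subst h
        simpa using hM
      have hn1 : (1 : ℝ) ≤ n := by exact_mod_cast h
      refine ne_top_of_le_ne_top (ENNReal.add_ne_top.2 ⟨hM, hAn⟩) ?_
      rw [← lintegral_add_left (by have := hf.continuous; fun_prop)]
      refine lintegral_mono fun x => ?_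
      rcases le_total ‖f x‖ₑ 1 with hx | hx
      · refine le_add_right ?_
        calc ‖f x‖ₑ ^ (((n : ℝ) + 2) / 2) ≤ ‖f x‖ₑ ^ (1 : ℝ) :=
              ENNReal.rpow_le_rpow_of_exponent_ge hx (by linarith)
          _ = _ := by simp
      · refine le_add_left ?_
        exact ENNReal.rpow_le_rpow_of_exponent_le hx (by linarith)
    have h2 := hK f hf0 hf (((n : ℝ) + 2) / 2) (by linarith) hfin
    rw [show 2 * (((n : ℝ) + 2) / 2) = (n : ℝ) + 1 + 1 by ring,
      show (n : ℝ) + 1 + 1 - 1 = n + 1 by ring] at h2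
    push_cast
    refine h2.trans ?_
    calc _ ≤ ↑K * ENNReal.ofReal (((n : ℝ) + 2) / 2) ^ (2 : ℝ) * (C * J ^ n * M) * J := by gcongr
      _ = _ := by
        rw [ENNReal.coe_rpow_of_nonneg _ (by norm_num : (0:ℝ) ≤ 2)]
        change _ = ↑K * (ENNReal.ofReal (((n : ℝ) + 2) / 2)) ^ (2 : ℝ) * C * J ^ (n + 1) * M
        ring

/-- For every `p ∈ [1, ∞)` there is a constant `C_p > 0` such that every nonnegative
`C¹` function `f` on `ℝ²` with finite mass `M := ∫ f` and finite Fisher information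
`I(f) := ∫ ‖∇f‖²/f` satisfies `‖f‖_{L^p} ≤ C_p M^{1/p} I(f)^{1-1/p}`. -/
theorem lp_bound_by_fisher (p : ℝ) (hp : 1 ≤ p) :
    ∃ C : ℝ, 0 < C ∧
      ∀ f : EuclideanSpace ℝ (Fin 2) → ℝ,
        (∀ x, 0 ≤ f x) → ContDiff ℝ 1 f → Integrable f →
        Integrable (fun x => ‖gradient f x‖ ^ 2 / f x) →
        eLpNorm f (ENNReal.ofReal p) volume ≤
          ENNReal.ofReal (C * (∫ x, f x) ^ (1 / p) *
            (∫ x, ‖gradient f x‖ ^ 2 / f x) ^ (1 - 1 / p)) := by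
  obtain ⟨n, hn⟩ := exists_nat_ge (p + 1)
  have hp0 : 0 < p := by linarith
  have hn0 : (0 : ℝ) < n := by linarith
  obtain ⟨C, hC⟩ := nat_bound n
  set θ : ℝ := (p - 1) / n with hθ
  have hθ0 : 0 ≤ θ := div_nonneg (by linarith) hn0.le
  have hθ1 : θ ≤ 1 := by rw [hθ, div_le_one hn0]; linarith
  have hnθ : (n : ℝ) * θ = p - 1 := by rw [hθ]; field_simp
  refine ⟨((C + 1 : ℝ≥0) : ℝ) ^ (θ * (1 / p)), by positivity, fun f hf0 hf hM hI => ?_⟩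
  have hI0 : ∀ x, 0 ≤ ‖gradient f x‖ ^ 2 / f x := fun x => div_nonneg (by positivity) (hf0 x)
  have eM : ∫⁻ x, ‖f x‖ₑ = ENNReal.ofReal (∫ x, f x) := by
    rw [ofReal_integral_eq_lintegral_ofReal hM (Eventually.of_forall hf0)]
    exact lintegral_congr fun x => Real.enorm_of_nonneg (hf0 x)
  have eI := ofReal_integral_eq_lintegral_ofReal hI (Eventually.of_forall hI0)
  have h1 := hC f hf0 hf (by rw [eM]; exact ENNReal.ofReal_ne_top)
    (by rw [← eI]; exact ENNReal.ofReal_ne_top)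
  rw [← eI, eM] at h1
  have hM0 : 0 ≤ ∫ x, f x := integral_nonneg hf0
  have hJ0 : 0 ≤ ∫ x, ‖gradient f x‖ ^ 2 / f x := integral_nonneg hI0
  set M := ∫ x, f x
  set J := ∫ x, ‖gradient f x‖ ^ 2 / f x
  have hA : ∫⁻ x, ‖f x‖ₑ ^ p ≤
      ((C + 1 : ℝ≥0) : ℝ≥0∞) ^ θ * ENNReal.ofReal J ^ (p - 1) * ENNReal.ofReal M := by
    have hfm := hf.continuous
    calc ∫⁻ x, ‖f x‖ₑ ^ p = ∫⁻ x, ‖f x‖ₑ ^ (1 - θ) * (‖f x‖ₑ ^ ((n : ℝ) + 1)) ^ θ := by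
          congr 1; ext x
          rw [← ENNReal.rpow_mul, ← ENNReal.rpow_add_of_nonneg _ _ (by linarith) (by positivity)]
          congr 1; linarith
      _ ≤ (∫⁻ x, ‖f x‖ₑ) ^ (1 - θ) * (∫⁻ x, ‖f x‖ₑ ^ ((n : ℝ) + 1)) ^ θ :=
          ENNReal.lintegral_mul_norm_pow_le (by fun_prop) (by fun_prop) (by linarith) hθ0 (by ring)
      _ ≤ ENNReal.ofReal M ^ (1 - θ) *
          (((C + 1 : ℝ≥0) : ℝ≥0∞) * ENNReal.ofReal J ^ n * ENNReal.ofReal M) ^ θ := by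
          rw [eM]
          gcongr
          refine h1.trans ?_
          gcongr
          simp
      _ = _ := by
          rw [ENNReal.mul_rpow_of_nonneg _ _ hθ0, ENNReal.mul_rpow_of_nonneg _ _ hθ0,
            ← ENNReal.rpow_natCast, ← ENNReal.rpow_mul, hnθ]
          have : ENNReal.ofReal M = ENNReal.ofReal M ^ (1 - θ) * ENNReal.ofReal M ^ θ := by
            rw [← ENNReal.rpow_add_of_nonneg _ _ (by linarith) hθ0]; simp
          conv_rhs => rw [this]
          ring
  rw [eLpNorm_eq_lintegral_rpow_enorm_toReal (by simpa using hp0) ENNReal.ofReal_ne_top,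
    ENNReal.toReal_ofReal hp0.le]
  have hp1 : 0 ≤ 1 / p := by positivity
  have hp2 : 0 ≤ 1 - 1 / p := by
    have : 1 / p ≤ 1 := by rw [div_le_one hp0]; exact hp
    linarith
  refine (ENNReal.rpow_le_rpow hA hp1).trans (le_of_eq ?_)
  rw [ENNReal.mul_rpow_of_nonneg _ _ hp1, ENNReal.mul_rpow_of_nonneg _ _ hp1,
    ← ENNReal.rpow_mul, ← ENNReal.rpow_mul, ENNReal.ofReal_mul (by positivity),
    ENNReal.ofReal_mul (by positivity), ← ENNReal.ofReal_rpow_of_nonneg hM0 hp1,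
    ← ENNReal.ofReal_rpow_of_nonneg hJ0 hp2,
    ← ENNReal.ofReal_rpow_of_nonneg (by positivity) (by positivity), ENNReal.ofReal_coe_nnreal,
    show (p - 1) * (1 / p) = 1 - 1 / p by field_simp]
  ring
end
end

section
/- For every q ∈ [1, 2) there exists a constant C_q > 0 such that every nonnegative, continuously differentiable function f on ℝ² with finite mass M := ∫_{ℝ²} f dx and finite Fisher information I(f) satisfies ‖∇f‖_{L^q(ℝ²)} ≤ C_q · M^{1/q − 1/2} · I(f)^{3/2 − 1/q}. -/
open MeasureTheory Real

noncomputable section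

open scoped ENNReal NNReal Topology
open Filter

local notation "E2" => EuclideanSpace ℝ (Fin 2)

/-- GNS inequality in dimension two for integrable (not compactly supported) functions. -/
lemma gns_two : ∃ K : ℝ≥0, ∀ u : E2 → ℝ, ContDiff ℝ 1 u → (∫⁻ x, ‖u x‖ₑ) ≠ ∞ →
    ∫⁻ x, ‖u x‖ₑ ^ (2:ℝ) ≤ K * (∫⁻ x, ‖fderiv ℝ u x‖ₑ) ^ (2:ℝ) := by
  refine ⟨lintegralPowLePowLIntegralFDerivConst (volume : Measure E2) 2, fun u hu hfin => ?_⟩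
  set K := lintegralPowLePowLIntegralFDerivConst (volume : Measure E2) 2
  have hconj : Real.HolderConjugate (Module.finrank ℝ E2) 2 := by
    simp only [finrank_euclideanSpace, Fintype.card_fin, Nat.cast_ofNat]
    exact Real.HolderConjugate.two_two
  let φ : ContDiffBump (0 : E2) := ⟨1, 2, by norm_num, by norm_num⟩
  have hφ : ContDiff ℝ 1 φ := φ.contDiff
  obtain ⟨L, hL⟩ : ∃ L : ℝ, ∀ x, ‖fderiv ℝ φ x‖ ≤ L :=
    (hφ.continuous_fderiv (by norm_num)).bounded_above_of_compact_support
      (φ.hasCompactSupport.fderiv (𝕜 := ℝ))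
  let ε : ℕ → ℝ := fun n => 1 / ((n:ℝ) + 1)
  have hεpos : ∀ n, 0 < ε n := fun n => by positivity
  have hε : Tendsto ε atTop (𝓝 0) := tendsto_one_div_add_atTop_nhds_zero_nat
  let v : ℕ → E2 → ℝ := fun n x => φ (ε n • x) * u x
  have hφn : ∀ n, ContDiff ℝ 1 (fun x : E2 => φ (ε n • x)) := fun n =>
    hφ.comp (contDiff_const_smul (ε n))
  have hv : ∀ n, ContDiff ℝ 1 (v n) := fun n => (hφn n).mul hu
  have hvs : ∀ n, HasCompactSupport (v n) := fun n =>
    (φ.hasCompactSupport.comp_smul (hεpos n).ne').mul_right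
  have hder : ∀ n x, ‖fderiv ℝ (v n) x‖ₑ ≤ ‖fderiv ℝ u x‖ₑ + ENNReal.ofReal (ε n * L) * ‖u x‖ₑ := by
    intro n x
    have h1 : fderiv ℝ (v n) x = φ (ε n • x) • fderiv ℝ u x
        + u x • (ε n • fderiv ℝ φ (ε n • x)) := by
      have := fderiv_mul (((hφn n).differentiable one_ne_zero) x) ((hu.differentiable one_ne_zero) x)
      rw [← fderiv_comp_smul (𝕜 := ℝ) (f := φ)]
      exact this
    rw [h1]
    refine (enorm_add_le (φ (ε n • x) • fderiv ℝ u x)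
      (u x • (ε n • fderiv ℝ φ (ε n • x)))).trans ?_
    rw [enorm_smul, enorm_smul, enorm_smul, mul_comm ‖u x‖ₑ]
    gcongr
    · have : ‖φ (ε n • x)‖ₑ ≤ 1 := by
        rw [← ofReal_norm, Real.norm_of_nonneg φ.nonneg]
        exact ENNReal.ofReal_le_one.2 φ.le_one
      calc _ ≤ 1 * ‖fderiv ℝ u x‖ₑ := by gcongr
        _ = _ := one_mul _
    · rw [← enorm_smul, ← ofReal_norm, norm_smul, Real.norm_of_nonneg (hεpos n).le]
      have := hεpos n
      gcongr
      exact hL _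
  have hlim : ∀ x, Tendsto (fun n => ‖v n x‖ₑ ^ (2:ℝ)) atTop (𝓝 (‖u x‖ₑ ^ (2:ℝ))) := by
    intro x
    have h1 : Tendsto (fun n => v n x) atTop (𝓝 (u x)) := by
      have h2 : Tendsto (fun n => φ (ε n • x)) atTop (𝓝 (φ ((0:ℝ) • x))) :=
        (φ.continuous.tendsto _).comp (hε.smul_const x)
      have h3 : φ ((0:ℝ) • x) = 1 := by
        rw [zero_smul]; exact φ.one_of_mem_closedBall (by simp [φ])
      rw [h3] at h2
      simpa using h2.mul_const (u x)
    exact (ENNReal.continuous_rpow_const.tendsto _).comp ((continuous_enorm.tendsto _).comp h1)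
  have hbd : ∀ n, ∫⁻ x, ‖v n x‖ₑ ^ (2:ℝ) ≤
      K * ((∫⁻ x, ‖fderiv ℝ u x‖ₑ) + ENNReal.ofReal (ε n * L) * ∫⁻ x, ‖u x‖ₑ) ^ (2:ℝ) := by
    intro n
    refine (lintegral_pow_le_pow_lintegral_fderiv volume (hv n) (hvs n) hconj).trans ?_
    gcongr
    calc _ ≤ ∫⁻ x, (‖fderiv ℝ u x‖ₑ + ENNReal.ofReal (ε n * L) * ‖u x‖ₑ) := lintegral_mono (hder n)
      _ = _ := by
        rw [lintegral_add_left ((hu.continuous_fderiv one_ne_zero).enorm.measurable),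
          lintegral_const_mul _ hu.continuous.enorm.measurable]
  have hlim2 : Tendsto (fun n => (K:ℝ≥0∞) * ((∫⁻ x, ‖fderiv ℝ u x‖ₑ) +
      ENNReal.ofReal (ε n * L) * ∫⁻ x, ‖u x‖ₑ) ^ (2:ℝ)) atTop
      (𝓝 (K * (∫⁻ x, ‖fderiv ℝ u x‖ₑ) ^ (2:ℝ))) := by
    refine ENNReal.Tendsto.const_mul ?_ (Or.inr ENNReal.coe_ne_top)
    refine (ENNReal.continuous_rpow_const.tendsto _).comp ?_
    have h1 : Tendsto (fun n => ENNReal.ofReal (ε n * L)) atTop (𝓝 0) := by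
      have := ENNReal.tendsto_ofReal (hε.mul_const L)
      simpa using this
    have h2 := ENNReal.Tendsto.mul_const h1 (Or.inr hfin)
    rw [zero_mul] at h2
    simpa using tendsto_const_nhds.add h2
  calc ∫⁻ x, ‖u x‖ₑ ^ (2:ℝ) = ∫⁻ x, liminf (fun n => ‖v n x‖ₑ ^ (2:ℝ)) atTop := by
        congr 1; ext x; exact (hlim x).liminf_eq.symm
    _ ≤ liminf (fun n => ∫⁻ x, ‖v n x‖ₑ ^ (2:ℝ)) atTop :=
        lintegral_liminf_le (fun n => ((hv n).continuous.enorm.measurable).pow_const _)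
    _ ≤ liminf (fun n => (K:ℝ≥0∞) * ((∫⁻ x, ‖fderiv ℝ u x‖ₑ) +
      ENNReal.ofReal (ε n * L) * ∫⁻ x, ‖u x‖ₑ) ^ (2:ℝ)) atTop :=
        liminf_le_liminf (Eventually.of_forall hbd)
    _ = _ := hlim2.liminf_eq

/-- Interpolation between the first and the `t`-th moments. -/
lemma interp_moment {F : E2 → ℝ≥0∞} (hF : Measurable F) {s t : ℝ} (hs : 1 ≤ s) (hst : s ≤ t)
    (ht : 1 < t) :
    ∫⁻ x, F x ^ s ≤ (∫⁻ x, F x) ^ ((t - s) / (t - 1)) *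
      (∫⁻ x, F x ^ t) ^ ((s - 1) / (t - 1)) := by
  have h0 : 0 < t - 1 := by linarith
  have ha : 0 ≤ (t - s) / (t - 1) := div_nonneg (by linarith) h0.le
  have hb : 0 ≤ (s - 1) / (t - 1) := div_nonneg (by linarith) h0.le
  refine le_trans (le_of_eq ?_) (ENNReal.lintegral_mul_norm_pow_le hF.aemeasurable
    (hF.pow_const t).aemeasurable ha hb (by field_simp; ring))
  congr 1; ext x
  rw [← ENNReal.rpow_mul, ← ENNReal.rpow_add_of_nonneg _ _ ha (by positivity)]
  congr 1
  field_simp; ring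

/-- One step of the moment recursion. -/
lemma moment_step {K : ℝ≥0} (hK : ∀ u : E2 → ℝ, ContDiff ℝ 1 u → (∫⁻ x, ‖u x‖ₑ) ≠ ∞ →
    ∫⁻ x, ‖u x‖ₑ ^ (2:ℝ) ≤ K * (∫⁻ x, ‖fderiv ℝ u x‖ₑ) ^ (2:ℝ))
    {f : E2 → ℝ} (hf0 : ∀ x, 0 ≤ f x) (hf : ContDiff ℝ 1 f) {J : E2 → ℝ≥0∞}
    (hJ : AEMeasurable J)
    (hG : ∀ x, ‖fderiv ℝ f x‖ₑ = ‖f x‖ₑ ^ (1/2:ℝ) * J x ^ (1/2:ℝ))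
    {r : ℝ} (hr : 2 ≤ r) (h1 : (∫⁻ x, ‖f x‖ₑ ^ (r / 2)) ≠ ∞) :
    ∫⁻ x, ‖f x‖ₑ ^ r ≤ K * ENNReal.ofReal (r/2) ^ (2:ℝ) * (∫⁻ x, ‖f x‖ₑ ^ (r - 1)) *
      ∫⁻ x, J x := by
  have hpow : ∀ (s : ℝ), 0 ≤ s → ∀ x, ‖f x ^ s‖ₑ = ‖f x‖ₑ ^ s := by
    intro s hs x
    rw [← ofReal_norm, ← ofReal_norm, Real.norm_of_nonneg (rpow_nonneg (hf0 x) _),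
      Real.norm_of_nonneg (hf0 x), ENNReal.ofReal_rpow_of_nonneg (hf0 x) hs]
  have hu : ContDiff ℝ 1 (fun x => f x ^ (r/2)) := by
    have := ContDiff.rpow_const_of_le (m := 1) (p := r/2) (by exact_mod_cast hf)
      (by push_cast; linarith)
    exact_mod_cast this
  have hmeas : Measurable (fun x => ‖f x‖ₑ) := hf.continuous.enorm.measurable
  have hmain := hK _ hu (by simpa only [hpow (r/2) (by linarith)] using h1)
  have e1 : ∀ x, ‖f x ^ (r/2)‖ₑ ^ (2:ℝ) = ‖f x‖ₑ ^ r := by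
    intro x
    rw [hpow _ (by linarith), ← ENNReal.rpow_mul]; congr 1; ring
  have e2 : ∀ x, ‖fderiv ℝ (fun x => f x ^ (r/2)) x‖ₑ =
      ENNReal.ofReal (r/2) * ((‖f x‖ₑ ^ (r-1)) ^ (1/2:ℝ) * J x ^ (1/2:ℝ)) := by
    intro x
    have hd := ((hf.differentiable one_ne_zero) x).hasFDerivAt.rpow_const (p := r/2)
      (Or.inr (by linarith))
    rw [hd.fderiv, enorm_smul, enorm_mul, hpow _ (by linarith), hG, ← ENNReal.rpow_mul,
      ← ofReal_norm (r/2), Real.norm_of_nonneg (by linarith)]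
    rw [show (r-1)*(1/2) = (r/2 - 1) + 1/2 by ring,
      ENNReal.rpow_add_of_nonneg _ _ (by linarith) (by norm_num)]
    ring
  simp only [e1, e2] at hmain
  refine hmain.trans ?_
  rw [lintegral_const_mul' _ _ ENNReal.ofReal_ne_top, ENNReal.mul_rpow_of_nonneg _ _ (by norm_num),
    ← mul_assoc, mul_assoc (_ * _) (lintegral _ _) (lintegral _ _)]
  gcongr
  calc _ ≤ ((∫⁻ x, ‖f x‖ₑ ^ (r - 1)) ^ (1/2:ℝ) * (∫⁻ x, J x) ^ (1/2:ℝ)) ^ (2:ℝ) := by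
        gcongr
        exact ENNReal.lintegral_mul_norm_pow_le (hmeas.pow_const _).aemeasurable hJ
          (by norm_num) (by norm_num) (by norm_num)
    _ = _ := by
        rw [ENNReal.mul_rpow_of_nonneg _ _ (by norm_num), ← ENNReal.rpow_mul, ← ENNReal.rpow_mul]
        norm_num

lemma moment_nat (n : ℕ) : ∃ C : ℝ≥0, ∀ (f : E2 → ℝ) (J : E2 → ℝ≥0∞), (∀ x, 0 ≤ f x) →
    ContDiff ℝ 1 f → AEMeasurable J →
    (∀ x, ‖fderiv ℝ f x‖ₑ = ‖f x‖ₑ ^ (1/2:ℝ) * J x ^ (1/2:ℝ)) →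
    (∫⁻ x, ‖f x‖ₑ) ≠ ∞ → (∫⁻ x, J x) ≠ ∞ →
    ∫⁻ x, ‖f x‖ₑ ^ ((n:ℝ) + 1) ≤ C * (∫⁻ x, ‖f x‖ₑ) * (∫⁻ x, J x) ^ n := by
  obtain ⟨K, hK⟩ := gns_two
  induction n with
  | zero => exact ⟨1, fun f J _ _ _ _ _ _ => by simp⟩
  | succ n ih =>
    obtain ⟨C, hC⟩ := ih
    refine ⟨K * (Real.toNNReal (((n:ℝ)+2)/2)) ^ (2:ℝ) * C, fun f J hf0 hf hJ hG hM hI => ?_⟩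
    have h := hC f J hf0 hf hJ hG hM hI
    have hmeas : Measurable (fun x => ‖f x‖ₑ) := hf.continuous.enorm.measurable
    have hn0 : (0:ℝ) ≤ n := n.cast_nonneg
    have hfin : (∫⁻ x, ‖f x‖ₑ ^ ((n:ℝ) + 1)) ≠ ∞ := ne_top_of_le_ne_top
      (ENNReal.mul_ne_top (ENNReal.mul_ne_top ENNReal.coe_ne_top hM) (ENNReal.pow_ne_top hI)) h
    have hhalf : (∫⁻ x, ‖f x‖ₑ ^ (((n:ℝ) + 2) / 2)) ≠ ∞ := by
      rcases Nat.eq_zero_or_pos n with rfl | hn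
      · simpa using hM
      · have hn1 : (1:ℝ) ≤ n := by exact_mod_cast hn
        refine ne_top_of_le_ne_top ?_ (interp_moment hmeas (s := ((n:ℝ)+2)/2) (t := (n:ℝ)+1)
          (by linarith) (by linarith) (by linarith))
        refine ENNReal.mul_ne_top (ENNReal.rpow_ne_top_of_nonneg ?_ hM)
          (ENNReal.rpow_ne_top_of_nonneg ?_ hfin)
        · exact div_nonneg (by linarith) (by linarith)
        · exact div_nonneg (by linarith) (by linarith)
    have hs := moment_step hK hf0 hf hJ hG (r := (n:ℝ)+2) (by linarith) hhalf
    rw [show (n:ℝ) + 2 - 1 = n + 1 by ring] at hs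
    rw [show ((n+1:ℕ):ℝ) + 1 = n + 2 by push_cast; ring]
    refine hs.trans ?_
    push_cast
    rw [ENNReal.coe_rpow_of_nonneg _ (by norm_num)]
    change _ * ENNReal.ofReal _ ^ (2:ℝ) * _ * _ ≤ _ * ENNReal.ofReal _ ^ (2:ℝ) * _ * _ * _
    calc _ ≤ K * ENNReal.ofReal (((n:ℝ)+2)/2) ^ (2:ℝ) *
          (C * (∫⁻ x, ‖f x‖ₑ) * (∫⁻ x, J x) ^ n) * ∫⁻ x, J x := by gcongr
      _ = _ := by ring

lemma moment_real (p : ℝ) (hp : 1 ≤ p) : ∃ C : ℝ≥0, ∀ (f : E2 → ℝ) (J : E2 → ℝ≥0∞),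
    (∀ x, 0 ≤ f x) → ContDiff ℝ 1 f → AEMeasurable J →
    (∀ x, ‖fderiv ℝ f x‖ₑ = ‖f x‖ₑ ^ (1/2:ℝ) * J x ^ (1/2:ℝ)) →
    (∫⁻ x, ‖f x‖ₑ) ≠ ∞ → (∫⁻ x, J x) ≠ ∞ →
    ∫⁻ x, ‖f x‖ₑ ^ p ≤ C * (∫⁻ x, ‖f x‖ₑ) * (∫⁻ x, J x) ^ (p - 1) := by
  obtain ⟨n, hn⟩ := exists_nat_ge p
  obtain ⟨C, hC⟩ := moment_nat n
  have hn1 : 1 ≤ (n:ℝ) := hp.trans hn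
  have hn0 : (0:ℝ) < n := by linarith
  refine ⟨C ^ ((p-1)/n), fun f J hf0 hf hJ hG hM hI => ?_⟩
  have h := hC f J hf0 hf hJ hG hM hI
  have hmeas : Measurable (fun x => ‖f x‖ₑ) := hf.continuous.enorm.measurable
  have hb : 0 ≤ (p-1)/n := div_nonneg (by linarith) hn0.le
  have ha : 0 ≤ (n+1-p)/n := div_nonneg (by linarith) hn0.le
  refine (interp_moment hmeas hp (t := n+1) (by linarith) (by linarith)).trans ?_
  rw [show (n:ℝ) + 1 - 1 = n by ring]
  calc _ ≤ (∫⁻ x, ‖f x‖ₑ) ^ ((n+1-p)/n) *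
        (C * (∫⁻ x, ‖f x‖ₑ) * (∫⁻ x, J x) ^ n) ^ ((p-1)/n) := by gcongr
    _ = C ^ ((p-1)/n) * ((∫⁻ x, ‖f x‖ₑ) ^ ((n+1-p)/n) * (∫⁻ x, ‖f x‖ₑ) ^ ((p-1)/n)) *
        ((∫⁻ x, J x) ^ (n:ℝ)) ^ ((p-1)/n) := by
      rw [ENNReal.mul_rpow_of_nonneg _ _ hb, ENNReal.mul_rpow_of_nonneg _ _ hb, ENNReal.rpow_natCast]
      ring
    _ = _ := by
      rw [← ENNReal.rpow_add_of_nonneg _ _ ha hb, ← ENNReal.rpow_mul,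
        show ((n:ℝ)+1-p)/n + (p-1)/n = 1 by field_simp; ring,
        show (n:ℝ) * ((p-1)/n) = p - 1 by field_simp, ENNReal.rpow_one,
        ENNReal.coe_rpow_of_nonneg _ hb]

theorem gradient_lq_bound_by_fisher (q : ℝ) (hq1 : 1 ≤ q) (hq2 : q < 2) :
    ∃ C : ℝ, 0 < C ∧
      ∀ f : EuclideanSpace ℝ (Fin 2) → ℝ,
        (∀ x, 0 ≤ f x) → ContDiff ℝ 1 f → Integrable f →
        Integrable (fun x => ‖gradient f x‖ ^ 2 / f x) →
        eLpNorm (fun x => gradient f x) (ENNReal.ofReal q) volume ≤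
          ENNReal.ofReal (C * (∫ x, f x) ^ (1 / q - 1 / 2) *
            (∫ x, ‖gradient f x‖ ^ 2 / f x) ^ (3 / 2 - 1 / q)) := by
  have hq0 : 0 < q := by linarith
  have h2q : 0 < 2 - q := by linarith
  have hp : 1 ≤ q / (2 - q) := by rw [le_div_iff₀ h2q]; linarith
  obtain ⟨C, hC⟩ := moment_real (q / (2-q)) hp
  have hα : 0 ≤ 1 / q - 1 / 2 := by
    have := one_div_le_one_div_of_le hq0 hq2.le
    linarith
  have hβ : 0 ≤ 3 / 2 - 1 / q := by
    have := one_div_le_one_div_of_le one_pos hq1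
    linarith
  refine ⟨(C:ℝ) ^ (1 / q - 1 / 2) + 1, by positivity, fun f hf0 hf hfi hJi => ?_⟩
  set j : E2 → ℝ := fun x => ‖gradient f x‖ ^ 2 / f x with hj
  have hj0 : ∀ x, 0 ≤ j x := fun x => div_nonneg (by positivity) (hf0 x)
  have hgn : ∀ x, ‖gradient f x‖ = ‖fderiv ℝ f x‖ := fun x => by
    rw [← toDual_gradient, LinearIsometryEquiv.norm_map]
  have hM : ∫⁻ x, ‖f x‖ₑ = ENNReal.ofReal (∫ x, f x) := by
    rw [ofReal_integral_eq_lintegral_ofReal hfi (Eventually.of_forall hf0)]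
    congr 1; ext x
    rw [← ofReal_norm, Real.norm_of_nonneg (hf0 x)]
  have hI : ∫⁻ x, ENNReal.ofReal (j x) = ENNReal.ofReal (∫ x, j x) := by
    rw [ofReal_integral_eq_lintegral_ofReal hJi (Eventually.of_forall hj0)]
  have hJm : AEMeasurable (fun x => ENNReal.ofReal (j x)) := hJi.aemeasurable.ennreal_ofReal
  have hG : ∀ x, ‖fderiv ℝ f x‖ₑ = ‖f x‖ₑ ^ (1/2:ℝ) * (ENNReal.ofReal (j x)) ^ (1/2:ℝ) := by
    intro x
    rw [← ENNReal.mul_rpow_of_nonneg _ _ (by norm_num), ← ofReal_norm,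
      ← ofReal_norm, Real.norm_of_nonneg (hf0 x), ← ENNReal.ofReal_mul (hf0 x)]
    have : f x * j x = ‖fderiv ℝ f x‖ ^ 2 := by
      simp only [hj, hgn]
      rcases eq_or_ne (f x) 0 with h0 | h0
      · have hmin : IsLocalMin f x := Eventually.of_forall fun y => by rw [h0]; exact hf0 y
        rw [hmin.fderiv_eq_zero, h0]; simp
      · field_simp
    rw [this, ENNReal.ofReal_rpow_of_nonneg (by positivity) (by norm_num), ← Real.sqrt_eq_rpow,
      Real.sqrt_sq (norm_nonneg _)]
  have hmom := hC f _ hf0 hf hJm hG (by rw [hM]; exact ENNReal.ofReal_ne_top)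
    (by rw [hI]; exact ENNReal.ofReal_ne_top)
  have hmeas : Measurable (fun x => ‖f x‖ₑ) := hf.continuous.enorm.measurable
  rw [eLpNorm_eq_lintegral_rpow_enorm_toReal (by simpa using hq0) ENNReal.ofReal_ne_top,
    ENNReal.toReal_ofReal hq0.le]
  have hge : ∀ x, ‖gradient f x‖ₑ = ‖fderiv ℝ f x‖ₑ := fun x => by
    rw [← ofReal_norm, ← ofReal_norm, hgn]
  simp only [hge]
  have hpt : ∀ x, ‖fderiv ℝ f x‖ₑ ^ q =
      (‖f x‖ₑ ^ (q/(2-q))) ^ (1 - q/2) * (ENNReal.ofReal (j x)) ^ (q/2) := by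
    intro x
    rw [hG, ENNReal.mul_rpow_of_nonneg _ _ hq0.le, ← ENNReal.rpow_mul, ← ENNReal.rpow_mul,
      ← ENNReal.rpow_mul]
    congr 2
    · field_simp
    · ring
  have hhol : ∫⁻ x, ‖fderiv ℝ f x‖ₑ ^ q ≤
      (∫⁻ x, ‖f x‖ₑ ^ (q/(2-q))) ^ (1 - q/2) * (∫⁻ x, ENNReal.ofReal (j x)) ^ (q/2) := by
    simp only [hpt]
    exact ENNReal.lintegral_mul_norm_pow_le (hmeas.pow_const _).aemeasurable hJm
      (by linarith) (by linarith) (by ring)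
  have hM0 : 0 ≤ ∫ x, f x := integral_nonneg hf0
  have hI0 : 0 ≤ ∫ x, j x := integral_nonneg hj0
  rw [hM, hI] at hmom
  rw [hI] at hhol
  have hc1 : 0 ≤ 1 - q/2 := by linarith
  have hc2 : 0 ≤ q/(2-q) - 1 := by linarith
  have hqi : 0 ≤ 1/q := by positivity
  calc _ ≤ ((C * ENNReal.ofReal (∫ x, f x) * ENNReal.ofReal (∫ x, j x) ^ (q/(2-q) - 1)) ^ (1 - q/2)
        * ENNReal.ofReal (∫ x, j x) ^ (q/2)) ^ (1/q) := by
        gcongr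
        refine hhol.trans ?_
        gcongr
    _ = (C:ℝ≥0∞) ^ (1/q - 1/2) * ENNReal.ofReal (∫ x, f x) ^ (1/q - 1/2) *
        ENNReal.ofReal (∫ x, j x) ^ (3/2 - 1/q) := by
        rw [ENNReal.mul_rpow_of_nonneg _ _ hqi, ENNReal.mul_rpow_of_nonneg _ _ hc1,
          ENNReal.mul_rpow_of_nonneg _ _ hc1, ENNReal.mul_rpow_of_nonneg _ _ hqi,
          ENNReal.mul_rpow_of_nonneg _ _ hqi]
        simp only [← ENNReal.rpow_mul]
        rw [mul_assoc, ← ENNReal.rpow_add_of_nonneg _ _ (by positivity) (by positivity),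
          show (1 - q/2) * (1/q) = 1/q - 1/2 by field_simp,
          show (q/(2-q) - 1) * (1 - q/2) * (1/q) + q/2 * (1/q) = 3/2 - 1/q by field_simp; ring]
    _ = ENNReal.ofReal ((C:ℝ) ^ (1/q - 1/2) * (∫ x, f x) ^ (1/q - 1/2) *
        (∫ x, j x) ^ (3/2 - 1/q)) := by
        rw [ENNReal.ofReal_mul (by positivity), ENNReal.ofReal_mul (by positivity),
          ENNReal.ofReal_rpow_of_nonneg hM0 hα, ENNReal.ofReal_rpow_of_nonneg hI0 hβ,
          ← ENNReal.ofReal_rpow_of_nonneg C.coe_nonneg hα, ENNReal.ofReal_coe_nnreal]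
    _ ≤ _ := by
        apply ENNReal.ofReal_le_ofReal
        gcongr
        linarith
end
end

section
/- For every p ∈ [2, ∞) there exists a constant C_p > 0 such that every nonnegative function f on ℝ² with finite mass M := ∫_{ℝ²} f dx, such that f^{p/2} is continuously differentiable with ∇(f^{p/2}) square-integrable, satisfies ‖f‖_{L^{p+1}(ℝ²)} ≤ C_p · M^{1/(p+1)} · ‖∇(f^{p/2})‖_{L²(ℝ²)}^{2/(p+1)}. -/
open MeasureTheory Real

noncomputable section

open Filter Topology in
/-- The `L¹` Sobolev inequality in the plane without compact support. -/
lemma sobolev_one_plane :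
    ∃ C : NNReal, ∀ v : EuclideanSpace ℝ (Fin 2) → ℝ, ContDiff ℝ 1 v →
      (∫⁻ x, ‖v x‖ₑ) ≠ ⊤ →
      ∫⁻ x, ‖v x‖ₑ ^ (2:ℝ) ≤ C * (∫⁻ x, ‖fderiv ℝ v x‖ₑ) ^ (2:ℝ) := by
  refine ⟨lintegralPowLePowLIntegralFDerivConst
    (volume : Measure (EuclideanSpace ℝ (Fin 2))) 2, fun v hv hfin => ?_⟩
  set C := lintegralPowLePowLIntegralFDerivConst
    (volume : Measure (EuclideanSpace ℝ (Fin 2))) 2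
  have hconj : Real.HolderConjugate (Module.finrank ℝ (EuclideanSpace ℝ (Fin 2))) 2 := by
    rw [finrank_euclideanSpace_fin]
    exact_mod_cast Real.HolderConjugate.two_two
  let χ : ContDiffBump (0 : EuclideanSpace ℝ (Fin 2)) := ⟨1, 2, one_pos, one_lt_two⟩
  have hχ : ContDiff ℝ 1 χ := χ.contDiff
  have hχc : HasCompactSupport χ := χ.hasCompactSupport
  obtain ⟨K, hK⟩ : ∃ K : NNReal, ∀ x, ‖fderiv ℝ χ x‖ ≤ K := by
    obtain ⟨K, hK⟩ := (hχc.fderiv (𝕜 := ℝ)).exists_bound_of_continuous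
      (hχ.continuous_fderiv one_ne_zero)
    exact ⟨K.toNNReal, fun x => (hK x).trans (Real.le_coe_toNNReal K)⟩
  let c : ℕ → NNReal := fun n => ((n:NNReal) + 1)⁻¹
  have hcpos : ∀ n, 0 < (c n : ℝ) := fun n => by simp only [c]; positivity
  have hc0 : Tendsto c atTop (𝓝 0) := by
    have := tendsto_one_div_add_atTop_nhds_zero_nat (𝕜 := ℝ)
    rw [← NNReal.tendsto_coe]
    simpa [c] using this
  let V : ℕ → EuclideanSpace ℝ (Fin 2) → ℝ := fun n x => χ ((c n : ℝ) • x) * v x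
  have hVs : ∀ n, ContDiff ℝ 1 (V n) := fun n =>
    (hχ.comp (contDiff_const_smul (c n : ℝ))).mul hv
  have hVc : ∀ n, HasCompactSupport (V n) := fun n =>
    HasCompactSupport.mul_right (hχc.comp_smul (hcpos n).ne')
  have hVd : ∀ n x, ‖fderiv ℝ (V n) x‖ₑ ≤ ‖fderiv ℝ v x‖ₑ + (c n * K : NNReal) * ‖v x‖ₑ := by
    intro n x
    have h1 : HasFDerivAt (fun x => χ ((c n : ℝ) • x)) ((c n : ℝ) • fderiv ℝ χ ((c n : ℝ) • x)) x := by
      have hd : HasFDerivAt χ (fderiv ℝ χ ((c n : ℝ) • x)) ((c n : ℝ) • x) :=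
        (hχ.differentiable one_ne_zero _).hasFDerivAt
      have := hd.comp x ((hasFDerivAt_id x).const_smul (c n : ℝ))
      convert! this using 1
      ext y; simp
    have h2 := h1.mul (hv.differentiable one_ne_zero x).hasFDerivAt
    have h3 : fderiv ℝ (V n) x = _ := h2.fderiv
    have h4 : ‖fderiv ℝ (V n) x‖ ≤ ‖fderiv ℝ v x‖ + (c n * K) * ‖v x‖ := by
      rw [h3]
      refine (norm_add_le _ _).trans (add_le_add ?_ ?_)
      · rw [norm_smul, Real.norm_of_nonneg χ.nonneg]
        exact mul_le_of_le_one_left (norm_nonneg _) χ.le_one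
      · rw [norm_smul, norm_smul, mul_comm, Real.norm_of_nonneg (hcpos n).le]
        gcongr
        exact hK _
    have h5 : ‖fderiv ℝ (V n) x‖₊ ≤ ‖fderiv ℝ v x‖₊ + (c n * K) * ‖v x‖₊ := by
      exact_mod_cast h4
    simp only [enorm_eq_nnnorm]
    exact_mod_cast h5
  have hB : ∀ n, ∫⁻ x, ‖V n x‖ₑ ^ (2:ℝ) ≤
      C * ((∫⁻ x, ‖fderiv ℝ v x‖ₑ) + (c n * K : NNReal) * ∫⁻ x, ‖v x‖ₑ) ^ (2:ℝ) := by
    intro n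
    refine (lintegral_pow_le_pow_lintegral_fderiv volume (hVs n) (hVc n) hconj).trans ?_
    gcongr
    refine (lintegral_mono (hVd n)).trans ?_
    rw [lintegral_add_left, lintegral_const_mul]
    · exact hv.continuous.enorm.measurable
    · exact (hv.continuous_fderiv one_ne_zero).enorm.measurable
  have hlim : Tendsto (fun n => (C : ENNReal) *
      ((∫⁻ x, ‖fderiv ℝ v x‖ₑ) + (c n * K : NNReal) * ∫⁻ x, ‖v x‖ₑ) ^ (2:ℝ)) atTop
      (𝓝 (C * (∫⁻ x, ‖fderiv ℝ v x‖ₑ) ^ (2:ℝ))) := by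
    refine ENNReal.Tendsto.const_mul ?_ (Or.inr ENNReal.coe_ne_top)
    refine Tendsto.ennrpow_const _ ?_
    have h0 : Tendsto (fun n => ((c n * K : NNReal) : ENNReal)) atTop (𝓝 0) := by
      have := hc0.mul_const K
      rw [zero_mul] at this
      exact ENNReal.tendsto_coe.2 this
    have h1 := ENNReal.Tendsto.mul_const h0 (b := ∫⁻ x, ‖v x‖ₑ) (Or.inr hfin)
    have h2 := h1.const_add (∫⁻ x, ‖fderiv ℝ v x‖ₑ)
    simpa using h2
  have hpt : ∀ x, Tendsto (fun n => ‖V n x‖ₑ ^ (2:ℝ)) atTop (𝓝 (‖v x‖ₑ ^ (2:ℝ))) := by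
    intro x
    refine Tendsto.ennrpow_const _ (Tendsto.enorm ?_)
    have h0 : Tendsto (fun n => (c n : ℝ) • x) atTop (𝓝 0) := by
      have : Tendsto (fun n => (c n : ℝ)) atTop (𝓝 0) := NNReal.tendsto_coe.2 hc0
      simpa using this.smul_const x
    have h1 := (hχ.continuous.tendsto 0).comp h0
    have h2 : χ 0 = 1 := χ.one_of_mem_closedBall (by simp [χ.rIn_pos.le])
    rw [h2] at h1
    simpa using h1.mul_const (v x)
  calc ∫⁻ x, ‖v x‖ₑ ^ (2:ℝ) = ∫⁻ x, liminf (fun n => ‖V n x‖ₑ ^ (2:ℝ)) atTop :=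
        lintegral_congr fun x => (hpt x).liminf_eq.symm
    _ ≤ liminf (fun n => ∫⁻ x, ‖V n x‖ₑ ^ (2:ℝ)) atTop :=
        lintegral_liminf_le fun n => ((hVs n).continuous.enorm.measurable.pow_const _)
    _ ≤ liminf (fun n => (C : ENNReal) *
      ((∫⁻ x, ‖fderiv ℝ v x‖ₑ) + (c n * K : NNReal) * ∫⁻ x, ‖v x‖ₑ) ^ (2:ℝ)) atTop :=
        liminf_le_liminf (Eventually.of_forall hB)
    _ = _ := hlim.liminf_eq

open Filter Topology in
/-- Sobolev for a nonnegative `w` such that each truncation `w/(1+εw)` is integrable. -/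
lemma sobolev_one_plane' :
    ∃ C : NNReal, ∀ w : EuclideanSpace ℝ (Fin 2) → ℝ, ContDiff ℝ 1 w → (∀ x, 0 ≤ w x) →
      (∀ ε : ℝ, 0 < ε → (∫⁻ x, ‖w x / (1 + ε * w x)‖ₑ) ≠ ⊤) →
      ∫⁻ x, ‖w x‖ₑ ^ (2:ℝ) ≤ C * (∫⁻ x, ‖fderiv ℝ w x‖ₑ) ^ (2:ℝ) := by
  obtain ⟨C, hC⟩ := sobolev_one_plane
  refine ⟨C, fun w hw hw0 hfin => ?_⟩
  let e : ℕ → ℝ := fun n => 1 / ((n:ℝ) + 1)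
  have he : ∀ n, 0 < e n := fun n => by simp only [e]; positivity
  have he0 : Tendsto e atTop (𝓝 0) := tendsto_one_div_add_atTop_nhds_zero_nat
  let V : ℕ → EuclideanSpace ℝ (Fin 2) → ℝ := fun n x => w x / (1 + e n * w x)
  have hpos : ∀ n x, 1 ≤ 1 + e n * w x := fun n x => by
    have := mul_nonneg (he n).le (hw0 x); linarith
  have hVs : ∀ n, ContDiff ℝ 1 (V n) := fun n =>
    hw.div (contDiff_const.add (contDiff_const.mul hw)) fun x => by have := hpos n x; positivity
  have hVd : ∀ n x, ‖fderiv ℝ (V n) x‖ₑ ≤ ‖fderiv ℝ w x‖ₑ := by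
    intro n x
    have hp := hpos n x
    have hne : 1 + e n * w x ≠ 0 := by positivity
    have h1 := (hw.differentiable one_ne_zero x).hasFDerivAt
    have hφ : HasDerivAt (fun t : ℝ => t / (1 + e n * t)) (1 / (1 + e n * w x) ^ 2) (w x) := by
      have h := (hasDerivAt_id (w x)).div (((hasDerivAt_id (w x)).const_mul (e n)).const_add 1) hne
      convert! h using 1
      simp only [id]
      congr 1
      ring
    have h3 : fderiv ℝ (V n) x = _ := (hφ.comp_hasFDerivAt x h1).fderiv
    rw [h3, enorm_smul]
    refine mul_le_of_le_one_left (zero_le) ?_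
    rw [Real.enorm_eq_ofReal (by positivity)]
    apply ENNReal.ofReal_le_one.2
    rw [div_le_one (by positivity)]
    exact one_le_pow₀ hp
  have hB : ∀ n, ∫⁻ x, ‖V n x‖ₑ ^ (2:ℝ) ≤ C * (∫⁻ x, ‖fderiv ℝ w x‖ₑ) ^ (2:ℝ) := by
    intro n
    refine (hC (V n) (hVs n) (hfin _ (he n))).trans ?_
    gcongr with x
    exact hVd n x
  have hpt : ∀ x, Tendsto (fun n => ‖V n x‖ₑ ^ (2:ℝ)) atTop (𝓝 (‖w x‖ₑ ^ (2:ℝ))) := by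
    intro x
    refine Tendsto.ennrpow_const _ (Tendsto.enorm ?_)
    have h1 : Tendsto (fun n => 1 + e n * w x) atTop (𝓝 1) := by
      simpa using (he0.mul_const (w x)).const_add 1
    have h2 := (tendsto_const_nhds (x := w x)).div h1 one_ne_zero
    rw [div_one] at h2
    exact h2
  calc ∫⁻ x, ‖w x‖ₑ ^ (2:ℝ) = ∫⁻ x, liminf (fun n => ‖V n x‖ₑ ^ (2:ℝ)) atTop :=
        lintegral_congr fun x => (hpt x).liminf_eq.symm
    _ ≤ liminf (fun n => ∫⁻ x, ‖V n x‖ₑ ^ (2:ℝ)) atTop :=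
        lintegral_liminf_le fun n => ((hVs n).continuous.enorm.measurable.pow_const _)
    _ ≤ liminf (fun n : ℕ => (C : ENNReal) * (∫⁻ x, ‖fderiv ℝ w x‖ₑ) ^ (2:ℝ)) atTop :=
        liminf_le_liminf (Eventually.of_forall hB)
    _ = _ := tendsto_const_nhds.liminf_eq

/-- For every `p ∈ [2, ∞)` there is a constant `C_p > 0` such that every nonnegative
function `f` on `ℝ²` with finite mass `M := ∫ f`, whose power `f^{p/2}` is `C¹` with
square-integrable gradient, satisfies
`‖f‖_{L^{p+1}} ≤ C_p M^{1/(p+1)} ‖∇(f^{p/2})‖_{L²}^{2/(p+1)}`. -/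
theorem lp_succ_bound_by_gradient_power (p : ℝ) (hp : 2 ≤ p) :
    ∃ C : ℝ, 0 < C ∧
      ∀ f : EuclideanSpace ℝ (Fin 2) → ℝ,
        (∀ x, 0 ≤ f x) → Integrable f →
        ContDiff ℝ 1 (fun x => f x ^ (p / 2)) →
        Integrable (fun x => ‖gradient (fun y => f y ^ (p / 2)) x‖ ^ 2) →
        eLpNorm f (ENNReal.ofReal (p + 1)) volume ≤
          ENNReal.ofReal (C * (∫ x, f x) ^ (1 / (p + 1)) *
            (∫ x, ‖gradient (fun y => f y ^ (p / 2)) x‖ ^ 2) ^ (1 / (p + 1))) := by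
  obtain ⟨C, hC⟩ := sobolev_one_plane'
  have hp1 : 0 < p + 1 := by linarith
  have hp0 : 0 < p := by linarith
  set a : ℝ := (p + 1) / p with ha
  have ha1 : 1 ≤ a := by rw [ha, le_div_iff₀ hp0]; linarith
  have ha0 : 0 < a := by linarith
  refine ⟨(C * a ^ 2 + 1) ^ (1 / (p + 1)), by positivity, fun f hf0 hf hg hG => ?_⟩
  set g : EuclideanSpace ℝ (Fin 2) → ℝ := fun x => f x ^ (p / 2) with hgdef
  set w : EuclideanSpace ℝ (Fin 2) → ℝ := fun x => g x ^ a with hwdef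
  have hg0 : ∀ x, 0 ≤ g x := fun x => Real.rpow_nonneg (hf0 x) _
  have hw0 : ∀ x, 0 ≤ w x := fun x => Real.rpow_nonneg (hg0 x) _
  have hws : ContDiff ℝ 1 w := by
    have : ContDiff ℝ ((1:ℕ) : WithTop ℕ∞) (fun t : ℝ => t ^ a) :=
      Real.contDiff_rpow_const_of_le (by simpa using ha1)
    exact (this.of_le (by simp)).comp hg
  have hwf : ∀ x, w x = f x ^ ((p + 1) / 2) := fun x => by
    simp only [hwdef, hgdef]
    rw [← Real.rpow_mul (hf0 x)]
    congr 1
    rw [ha]; field_simp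
  have hMfin : ∫⁻ x, ‖f x‖ₑ ≠ ⊤ := hf.2.ne
  have htr : ∀ ε : ℝ, 0 < ε → (∫⁻ x, ‖w x / (1 + ε * w x)‖ₑ) ≠ ⊤ := by
    intro ε hε
    refine ne_top_of_le_ne_top (ENNReal.mul_ne_top (ENNReal.coe_ne_top (r := (1 + 1/ε).toNNReal)) hMfin) ?_
    rw [← lintegral_const_mul' _ _ ENNReal.coe_ne_top]
    refine lintegral_mono fun x => ?_
    have hwx := hw0 x
    have key : w x / (1 + ε * w x) ≤ (1 + 1/ε) * f x := by
      have hfx := hf0 x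
      have hi : 0 < 1 / ε := by positivity
      rcases le_total (f x) 1 with h | h
      · calc w x / (1 + ε * w x) ≤ w x := div_le_self hwx (by nlinarith [mul_nonneg hε.le hwx])
          _ ≤ f x := by
            rw [hwf]
            calc f x ^ ((p+1)/2) ≤ f x ^ (1:ℝ) :=
                  Real.rpow_le_rpow_of_exponent_ge_of_imp hfx h (by linarith) (by intro _ h; linarith)
              _ = f x := Real.rpow_one _
          _ ≤ _ := by nlinarith
      · calc w x / (1 + ε * w x) ≤ 1 / ε := by
              rw [div_le_div_iff₀ (by positivity) hε]; nlinarith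
          _ ≤ _ := by nlinarith
    rw [Real.enorm_eq_ofReal (by positivity), Real.enorm_eq_ofReal (hf0 x)]
    change _ ≤ ENNReal.ofReal (1 + 1/ε) * _
    rw [← ENNReal.ofReal_mul (by positivity)]
    exact ENNReal.ofReal_le_ofReal key
  have hS := hC w hws hw0 htr
  have hder : ∀ x, ‖fderiv ℝ w x‖ₑ ≤
      ENNReal.ofReal a * (‖f x‖ₑ ^ (1/2:ℝ) * ‖gradient g x‖ₑ) := by
    intro x
    have h1 := (hg.differentiable one_ne_zero x).hasFDerivAt
    have h2 : fderiv ℝ w x = _ :=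
      ((Real.hasDerivAt_rpow_const (x := g x) (p := a) (Or.inr ha1)).comp_hasFDerivAt x h1).fderiv
    have hgn : ‖gradient g x‖ₑ = ‖fderiv ℝ g x‖ₑ := by
      rw [gradient]; simp [enorm_eq_nnnorm]
    rw [h2, enorm_smul, hgn, ← mul_assoc]
    refine le_of_eq ?_
    congr 1
    have h4 : g x ^ (a - 1) = f x ^ (1/2:ℝ) := by
      simp only [hgdef]
      rw [← Real.rpow_mul (hf0 x)]
      congr 1
      rw [ha]; field_simp; ring
    rw [h4, Real.enorm_eq_ofReal (mul_nonneg ha0.le (Real.rpow_nonneg (hf0 x) _)), ENNReal.ofReal_mul ha0.le,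
      Real.enorm_eq_ofReal (hf0 x), ENNReal.ofReal_rpow_of_nonneg (hf0 x) (by norm_num)]
  have hgradm : AEMeasurable (fun x => ‖gradient g x‖ₑ) volume := by
    have : (fun x => ‖gradient g x‖ₑ) = fun x => ‖fderiv ℝ g x‖ₑ := by
      ext x; rw [gradient]; simp [enorm_eq_nnnorm]
    rw [this]
    exact (hg.continuous_fderiv one_ne_zero).enorm.measurable.aemeasurable
  have hCS : ∫⁻ x, ‖fderiv ℝ w x‖ₑ ≤ ENNReal.ofReal a *
      ((∫⁻ x, ‖f x‖ₑ) ^ (1/2:ℝ) * (∫⁻ x, ‖gradient g x‖ₑ ^ (2:ℝ)) ^ (1/2:ℝ)) := by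
    refine (lintegral_mono hder).trans ?_
    rw [lintegral_const_mul' _ _ ENNReal.ofReal_ne_top]
    gcongr
    have h := ENNReal.lintegral_mul_le_Lp_mul_Lq volume Real.HolderConjugate.two_two
      (hf.1.enorm.pow_const (1/2:ℝ)) hgradm
    refine h.trans (le_of_eq ?_)
    congr 2
    refine lintegral_congr fun x => ?_
    rw [← ENNReal.rpow_mul]; norm_num
  have hM : ∫⁻ x, ‖f x‖ₑ = ENNReal.ofReal (∫ x, f x) := by
    rw [ofReal_integral_eq_lintegral_ofReal hf (Filter.Eventually.of_forall hf0)]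
    exact lintegral_congr fun x => Real.enorm_eq_ofReal (hf0 x)
  have hD : ∫⁻ x, ‖gradient g x‖ₑ ^ (2:ℝ) = ENNReal.ofReal (∫ x, ‖gradient g x‖ ^ 2) := by
    rw [ofReal_integral_eq_lintegral_ofReal hG (Filter.Eventually.of_forall fun x => by positivity)]
    refine lintegral_congr fun x => ?_
    rw [← ofReal_norm, ENNReal.ofReal_rpow_of_nonneg (norm_nonneg _) (by norm_num)]
    norm_num
  have hM0 : 0 ≤ ∫ x, f x := integral_nonneg hf0
  have hD0 : 0 ≤ ∫ x, ‖gradient g x‖ ^ 2 := integral_nonneg fun x => by positivity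
  rw [hM, hD] at hCS
  have hfw : ∫⁻ x, ‖f x‖ₑ ^ (p+1) = ∫⁻ x, ‖w x‖ₑ ^ (2:ℝ) := by
    refine lintegral_congr fun x => ?_
    rw [Real.enorm_eq_ofReal (hw0 x), Real.enorm_eq_ofReal (hf0 x), hwf,
      ENNReal.ofReal_rpow_of_nonneg (hf0 x) hp1.le,
      ENNReal.ofReal_rpow_of_nonneg (Real.rpow_nonneg (hf0 x) _) (by norm_num),
      ← Real.rpow_mul (hf0 x)]
    congr 2
    ring
  set M := ∫ x, f x
  set D := ∫ x, ‖gradient g x‖ ^ 2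
  have hfinal : ∫⁻ x, ‖f x‖ₑ ^ (p+1) ≤ ENNReal.ofReal ((C * a ^ 2 + 1) * M * D) := by
    rw [hfw]
    calc _ ≤ _ := hS
      _ ≤ C * (ENNReal.ofReal a * (ENNReal.ofReal M ^ (1/2:ℝ) * ENNReal.ofReal D ^ (1/2:ℝ))) ^ (2:ℝ) := by
        gcongr
      _ = ENNReal.ofReal (C * a ^ 2 * M * D) := by
        rw [ENNReal.mul_rpow_of_nonneg _ _ (by norm_num), ENNReal.mul_rpow_of_nonneg _ _ (by norm_num),
          ← ENNReal.rpow_mul, ← ENNReal.rpow_mul, ENNReal.ofReal_mul (by positivity),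
          ENNReal.ofReal_mul (by positivity), ENNReal.ofReal_mul (by positivity),
          ENNReal.ofReal_pow ha0.le, ENNReal.ofReal_coe_nnreal]
        norm_num
        ring
      _ ≤ _ := by
        apply ENNReal.ofReal_le_ofReal
        gcongr
        linarith
  rw [eLpNorm_eq_lintegral_rpow_enorm_toReal (by simpa using hp1) ENNReal.ofReal_ne_top,
    ENNReal.toReal_ofReal hp1.le]
  calc _ ≤ (ENNReal.ofReal ((C * a ^ 2 + 1) * M * D)) ^ (1 / (p+1)) := by gcongr
    _ = _ := by
      rw [ENNReal.ofReal_rpow_of_nonneg (by positivity) (by positivity),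
        Real.mul_rpow (by positivity) hD0, Real.mul_rpow (by positivity) hM0]
end
end

section
/- For every M ∈ (0, 8π) there exists a constant C₄ = C₄(M) such that every nonnegative integrable function f on ℝ² with ∫_{ℝ²} f dx = M, with ∫_{ℝ²} f |log f| dx < ∞ and ∬_{ℝ²×ℝ²} f(x) f(y) |log|x−y|| dx dy < ∞, satisfies ∫_{ℝ²} f log f dx ≤ (1 − M/(8π))^{−1} · F(f) + C₄, where F(f) := ∫_{ℝ²} f log f dx + (1/(4π)) ∬_{ℝ²×ℝ²} f(x) f(y) log|x−y| dx dy. -/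
open MeasureTheory Real

noncomputable section

/-- The potential function of the dyadic induction. -/
def GG (m : ℝ) : ℝ := m * log m - (1 - m) * log (1 - m) - 2 * m ^ 2 - m

lemma tangent_bound (K : ℝ) (hK : 0 < K) (p q r : ℝ) (hp : 0 ≤ p) (hq : 0 ≤ q) (hr : 0 ≤ r)
    (hs : p + q + r = 1) :
    p * log (p + q) + p * log (p + r) - p * log p ≤
      q * r / K + p * (log K + 1 / K - 1) := by
  rcases hp.eq_or_lt with h | hp
  · subst h
    simp
    positivity
  · have h1 : 0 < p + q := by linarith
    have h2 : 0 < p + r := by linarith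
    have h3 := log_le_sub_one_of_pos (show 0 < (p + q) * (p + r) / (p * K) by positivity)
    rw [log_div (by positivity) (by positivity), log_mul h1.ne' h2.ne', log_mul hp.ne' hK.ne'] at h3
    have h4 : (p + q) * (p + r) = p + q * r := by
      have : r = 1 - p - q := by linarith
      subst this; ring
    rw [h4] at h3
    have h5 := mul_le_mul_of_nonneg_left h3 hp.le
    have h6 : p * ((p + q * r) / (p * K) - 1) = q * r / K + p * (1 / K - 1) := by
      field_simp
      ring
    nlinarith

lemma GG_binary_aux (p q r : ℝ) (hp : 0 ≤ p) (hq : 0 ≤ q) (hr : 0 ≤ r)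
    (hs : p + q + r = 1) (hpq : p ≤ q) :
    GG (p + q) ≤ GG p + GG q + log 2 * (p - p ^ 2 + q - q ^ 2) := by
  have e1 : 1 - (p + q) = r := by linarith
  have e2 : 1 - p = q + r := by linarith
  have e3 : 1 - q = p + r := by linarith
  unfold GG
  rw [e1, e2, e3]
  have hl1 := Real.log_two_gt_d9
  have hl2 := Real.log_two_lt_d9
  set l := log 2
  have a1 := tangent_bound 2 (by norm_num) p q r hp hq hr hs
  have a2 := tangent_bound 1 (by norm_num) q p r hq hp hr (by linarith)
  have a2' := tangent_bound 2 (by norm_num) q p r hq hp hr (by linarith)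
  have a3 := tangent_bound 1 (by norm_num) r p q hr hp hq (by linarith)
  simp only [log_one] at a2 a3
  rw [add_comm q p] at a2 a2'
  rw [add_comm r p, add_comm r q] at a3
  have hr' : r = 1 - p - q := by linarith
  have hpq0 : 0 ≤ p * q := mul_nonneg hp hq
  have hpr0 : 0 ≤ p * r := mul_nonneg hp hr
  have hqr0 : 0 ≤ q * r := mul_nonneg hq hr
  by_cases hc : p ≤ 0.38 * q
  · have key : q * r / 2 + p * (l + 1 / 2 - 1) + p * r + p * q ≤
        l * (p - p ^ 2 + q - q ^ 2) + 4 * (p * q) := by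
      have k1 : p * r ≤ 0.38 * (q * r) := by nlinarith
      have k2 : p * p ≤ p * q := by nlinarith
      have k3 : p - p ^ 2 + q - q ^ 2 = p * r + q * r + 2 * (p * q) := by subst hr'; ring
      have k4 : p = p * p + p * q + p * r := by subst hr'; ring
      have k5 : p * (l + 1 / 2 - 1) = (l - 1 / 2) * (p * p + p * q + p * r) := by
        rw [← k4]; ring
      rw [k3, k5]
      nlinarith
    nlinarith
  · push Not at hc
    have key : q * r / 2 + p * (l + 1 / 2 - 1) + p * r / 2 + q * (l + 1 / 2 - 1) + p * q ≤
        l * (p - p ^ 2 + q - q ^ 2) + 4 * (p * q) := by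
      have k2 : p * p ≤ p * q := by nlinarith
      have k1 : 0.38 * (q * q) ≤ p * q := by nlinarith
      have k3 : p - p ^ 2 + q - q ^ 2 = p * r + q * r + 2 * (p * q) := by subst hr'; ring
      have k4 : p + q = p * p + q * q + 2 * (p * q) + (p * r + q * r) := by subst hr'; ring
      have k5 : p * (l + 1 / 2 - 1) + q * (l + 1 / 2 - 1) =
        (l - 1 / 2) * (p * p + q * q + 2 * (p * q) + (p * r + q * r)) := by
        rw [← k4]; ring
      rw [k3]
      nlinarith
    nlinarith

lemma GG_binary (p q : ℝ) (hp : 0 ≤ p) (hq : 0 ≤ q) (hs : p + q ≤ 1) :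
    GG (p + q) ≤ GG p + GG q + log 2 * (p - p ^ 2 + q - q ^ 2) := by
  rcases le_total p q with h | h
  · exact GG_binary_aux p q (1 - p - q) hp hq (by linarith) (by ring) h
  · have := GG_binary_aux q p (1 - p - q) hq hp (by linarith) (by ring) h
    rw [add_comm q p] at this
    linarith

lemma GG_quad (a b c d : ℝ) (ha : 0 ≤ a) (hb : 0 ≤ b) (hc : 0 ≤ c) (hd : 0 ≤ d)
    (hs : a + b + c + d ≤ 1) :
    GG (a + b + c + d) ≤ (GG a + 2 * log 2 * (a - a ^ 2)) + (GG b + 2 * log 2 * (b - b ^ 2))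
      + (GG c + 2 * log 2 * (c - c ^ 2)) + (GG d + 2 * log 2 * (d - d ^ 2)) := by
  have h1 := GG_binary a b ha hb (by linarith)
  have h2 := GG_binary c d hc hd (by linarith)
  have h3 := GG_binary (a + b) (c + d) (by linarith) (by linarith) (by linarith)
  have hl : 0 ≤ log 2 := log_nonneg (by norm_num)
  have h4 : log 2 * ((a + b) - (a + b) ^ 2 + (c + d) - (c + d) ^ 2) ≤
      log 2 * (a - a ^ 2 + b - b ^ 2 + (c - c ^ 2 + d - d ^ 2)) := by
    apply mul_le_mul_of_nonneg_left _ hl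
    nlinarith [mul_nonneg ha hb, mul_nonneg hc hd]
  rw [show a + b + c + d = (a + b) + (c + d) by ring]
  linarith

lemma GG_le (m : ℝ) (h1 : m ≤ 1) : GG m ≤ m * log m := by
  have h : -((1 - m) * log (1 - m)) ≤ m := by
    rcases (show 0 ≤ 1 - m by linarith).eq_or_lt with h | h
    · rw [← h]; simp; linarith
    · have := one_sub_inv_le_log_of_pos h
      have := mul_le_mul_of_nonneg_left this h.le
      rw [mul_sub, mul_inv_cancel₀ h.ne'] at this
      linarith
  unfold GG
  nlinarith [sq_nonneg m]

lemma sum_range_double (F : ℕ → ℝ) (n : ℕ) :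
    ∑ i ∈ Finset.range (2 * n), F i = ∑ i ∈ Finset.range n, (F (2 * i) + F (2 * i + 1)) := by
  induction n with
  | zero => simp
  | succ n ih =>
    rw [show 2 * (n + 1) = 2 * n + 1 + 1 by ring, Finset.sum_range_succ, Finset.sum_range_succ, ih,
      Finset.sum_range_succ]
    ring

/-- Sum over the cells of level `k`. -/
def lev (k : ℕ) (F : ℕ → ℕ → ℝ) : ℝ :=
  ∑ i ∈ Finset.range (2 ^ k), ∑ j ∈ Finset.range (2 ^ k), F i j

lemma lev_succ (k : ℕ) (F : ℕ → ℕ → ℝ) :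
    lev (k + 1) F = lev k (fun i j => F (2 * i) (2 * j) + F (2 * i) (2 * j + 1)
      + F (2 * i + 1) (2 * j) + F (2 * i + 1) (2 * j + 1)) := by
  unfold lev
  rw [pow_succ, mul_comm, sum_range_double]
  apply Finset.sum_congr rfl
  intro i _
  rw [sum_range_double, sum_range_double, ← Finset.sum_add_distrib]
  apply Finset.sum_congr rfl
  intro j _
  ring

lemma lev_add (k : ℕ) (F H : ℕ → ℕ → ℝ) :
    lev k (fun i j => F i j + H i j) = lev k F + lev k H := by
  simp [lev, Finset.sum_add_distrib]

lemma lev_mul (k : ℕ) (c : ℝ) (F : ℕ → ℕ → ℝ) :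
    lev k (fun i j => c * F i j) = c * lev k F := by
  simp [lev, Finset.mul_sum]

lemma lev_mono (k : ℕ) (F H : ℕ → ℕ → ℝ) (h : ∀ i j, F i j ≤ H i j) : lev k F ≤ lev k H := by
  unfold lev
  exact Finset.sum_le_sum fun i _ => Finset.sum_le_sum fun j _ => h i j

lemma tree (m : ℕ → ℕ → ℕ → ℝ) (h0 : ∀ k i j, 0 ≤ m k i j) (h1 : ∀ k i j, m k i j ≤ 1)
    (hc : ∀ k i j, m k i j = m (k + 1) (2 * i) (2 * j) + m (k + 1) (2 * i) (2 * j + 1)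
      + m (k + 1) (2 * i + 1) (2 * j) + m (k + 1) (2 * i + 1) (2 * j + 1))
    (hm : m 0 0 0 = 1) (K : ℕ) :
    2 * log 2 * ∑ k ∈ Finset.range K, lev (k + 1) (fun i j => m (k + 1) i j ^ 2) - 3 ≤
      lev K (fun i j => m K i j * log (m K i j)) + 2 * log 2 * K := by
  have tot : ∀ k, lev k (fun i j => m k i j) = 1 := by
    intro k
    induction k with
    | zero => simp [lev, hm]
    | succ k ih =>
      rw [lev_succ, ← ih]
      congr 1
      ext i j
      rw [hc k i j]
  have main : ∀ K : ℕ,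
    2 * log 2 * ∑ k ∈ Finset.range K, lev (k + 1) (fun i j => m (k + 1) i j ^ 2) - 3 ≤
      lev K (fun i j => GG (m K i j)) + 2 * log 2 * K := by
    intro K
    induction K with
    | zero => simp [lev, hm, GG]; norm_num
    | succ K ih =>
      have step : lev K (fun i j => GG (m K i j)) ≤
          lev (K + 1) (fun i j => GG (m (K + 1) i j) + 2 * log 2 *
            (m (K + 1) i j + (-1) * m (K + 1) i j ^ 2)) := by
        rw [lev_succ]
        apply lev_mono
        intro i j
        have h := hc K i j
        have := GG_quad _ _ _ _ (h0 (K+1) (2 * i) (2 * j)) (h0 (K+1) (2 * i) (2 * j+1))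
          (h0 (K+1) (2 * i+1) (2 * j)) (h0 (K+1) (2 * i+1) (2 * j+1)) (by rw [← h]; exact h1 _ _ _)
        rw [← h] at this
        linarith
      rw [lev_add, lev_mul, lev_add, lev_mul, tot] at step
      rw [Finset.sum_range_succ]
      push_cast
      linarith
  have := lev_mono K _ _ (fun i j => GG_le (m K i j) (h1 K i j))
  linarith [main K]

lemma geom_bound (K : ℕ) : ∀ r : ℝ, 0 < r → r ≤ 2 →
    min (K * log 2) (-log r) - 8 * log 2 + 4 * log 2 * r ≤
      log 2 * ∑ k ∈ Finset.range K, max 0 (1 - 2 * (2 ^ (k + 1) * r)) := by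
  have hl : 0 < log 2 := log_pos (by norm_num)
  induction K with
  | zero =>
    intro r h0 h2
    have := min_le_left 0 (-log r)
    simp
    nlinarith
  | succ K ih =>
    intro r h0 h2
    by_cases h1 : r ≤ 1
    · have := ih (2 * r) (by linarith) (by linarith)
      rw [Finset.sum_range_succ', log_mul (by norm_num) h0.ne'] at *
      have e : ∀ k : ℕ, (1 - 2 * (2 ^ (k + 1) * (2 * r))) = 1 - 2 * (2 ^ (k + 1 + 1) * r) := by
        intro k; ring
      simp only [e] at this
      have h3 : min ((↑(K + 1) : ℝ) * log 2) (-log r) =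
        min (K * log 2) (-(log 2 + log r)) + log 2 := by
        rw [← min_add_add_right]
        congr 1
        · push_cast; ring
        · ring
      have h4 := le_max_right 0 (1 - 2 * (2 ^ (0 + 1) * r))
      have h5 := mul_le_mul_of_nonneg_left h4 hl.le
      rw [h3, mul_add]
      rw [zero_add, pow_one] at h5 ⊢
      linarith
    · push Not at h1
      have h3 := min_le_right ((↑(K + 1) : ℝ) * log 2) (-log r)
      have h4 := log_pos h1
      have h5 : 0 ≤ log 2 * ∑ k ∈ Finset.range (K+1), max 0 (1 - 2 * (2 ^ (k + 1) * r)) :=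
        mul_nonneg hl.le (Finset.sum_nonneg fun i _ => le_max_left _ _)
      nlinarith

lemma floor_shift (a : ℕ) (u v : ℝ) :
    IntervalIntegrable (fun t : ℝ => (⌊(a:ℝ) * (v + t)⌋ : ℝ) - ⌊(a:ℝ) * (u + t)⌋) volume 0 1 ∧
    ∫ t in (0:ℝ)..1, ((⌊(a:ℝ) * (v + t)⌋ : ℝ) - ⌊(a:ℝ) * (u + t)⌋) = a * (v - u) := by
  have hmono : Monotone (fun t : ℝ => (⌊(a:ℝ) * t⌋ : ℝ)) := by
    intro s t hst
    simp only [Int.cast_le]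
    exact Int.floor_le_floor (mul_le_mul_of_nonneg_left hst (Nat.cast_nonneg a))
  have hI : ∀ b c : ℝ, IntervalIntegrable (fun t : ℝ => (⌊(a:ℝ) * t⌋ : ℝ)) volume b c :=
    fun b c => hmono.intervalIntegrable
  have hmono2 : ∀ w : ℝ, Monotone (fun t : ℝ => (⌊(a:ℝ) * (w + t)⌋ : ℝ)) := by
    intro w s t hst
    exact hmono (by linarith : w + s ≤ w + t)
  have hper : ∀ t : ℝ, (⌊(a:ℝ) * (1 + t)⌋ : ℝ) = ⌊(a:ℝ) * t⌋ + a := by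
    intro t
    rw [mul_add, mul_one, add_comm, Int.floor_add_natCast]
    push_cast; rfl
  refine ⟨(hmono2 v).intervalIntegrable.sub (hmono2 u).intervalIntegrable, ?_⟩
  rw [intervalIntegral.integral_sub (hmono2 v).intervalIntegrable (hmono2 u).intervalIntegrable]
  rw [intervalIntegral.integral_comp_add_left (fun t : ℝ => (⌊(a:ℝ) * t⌋ : ℝ)) v,
    intervalIntegral.integral_comp_add_left (fun t : ℝ => (⌊(a:ℝ) * t⌋ : ℝ)) u]
  rw [intervalIntegral.integral_interval_sub_interval_comm (hI _ _) (hI _ _) (hI _ _)]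
  have h2 : ∫ t in (v + 1)..(u + 1), (⌊(a:ℝ) * t⌋ : ℝ) = ∫ t in v..u, ((⌊(a:ℝ) * t⌋ : ℝ) + a) := by
    rw [add_comm v 1, add_comm u 1, ← intervalIntegral.integral_comp_add_left]
    simp only [hper]
  have h3 : ∫ t in (v + 0)..(u + 0), (⌊(a:ℝ) * t⌋ : ℝ) = ∫ t in v..u, (⌊(a:ℝ) * t⌋ : ℝ) := by simp
  rw [h2, h3, intervalIntegral.integral_add (hI _ _) (by simp)]
  simp
  ring

lemma floor_shift_abs (a : ℕ) (u v : ℝ) :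
    IntervalIntegrable (fun t : ℝ => |(⌊(a:ℝ) * (v + t)⌋ : ℝ) - ⌊(a:ℝ) * (u + t)⌋|) volume 0 1 ∧
    ∫ t in (0:ℝ)..1, |(⌊(a:ℝ) * (v + t)⌋ : ℝ) - ⌊(a:ℝ) * (u + t)⌋| = a * |v - u| := by
  have key : ∀ u v : ℝ, u ≤ v → ∀ t : ℝ,
      |(⌊(a:ℝ) * (v + t)⌋ : ℝ) - ⌊(a:ℝ) * (u + t)⌋| = 
      (⌊(a:ℝ) * (v + t)⌋ : ℝ) - ⌊(a:ℝ) * (u + t)⌋ := by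
    intro u v h t
    apply abs_of_nonneg
    rw [sub_nonneg, Int.cast_le]
    exact Int.floor_le_floor (mul_le_mul_of_nonneg_left (by linarith) (Nat.cast_nonneg a))
  rcases le_total u v with h | h
  · simp only [key u v h]
    rw [abs_of_nonneg (by linarith)]
    exact floor_shift a u v
  · have : ∀ t : ℝ, |(⌊(a:ℝ) * (v + t)⌋ : ℝ) - ⌊(a:ℝ) * (u + t)⌋| = 
      (⌊(a:ℝ) * (u + t)⌋ : ℝ) - ⌊(a:ℝ) * (v + t)⌋ := by
      intro t; rw [abs_sub_comm, key v u h]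
    simp only [this]
    rw [abs_sub_comm, abs_of_nonneg (by linarith)]
    exact floor_shift a v u

/-- The plane. -/
abbrev Pl := EuclideanSpace ℝ (Fin 2)

/-- index of the level `k` interval containing the coordinate `a`, grid shifted by `t`. -/
def idx (L : ℝ) (k : ℕ) (t a : ℝ) : ℤ := ⌊(2:ℝ) ^ k * ((a / L + 1 / 2 + t) / 2)⌋

lemma idx_succ (L : ℝ) (k : ℕ) (t a : ℝ) : idx L k t a = idx L (k + 1) t a / 2 := by
  unfold idx
  have := Int.floor_div_natCast ((2:ℝ) ^ (k + 1) * ((a / L + 1 / 2 + t) / 2)) 2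
  push_cast at this
  rw [← this]
  congr 1
  rw [pow_succ]; ring

lemma idx_range (L : ℝ) (hL : 0 < L) (k : ℕ) (t a : ℝ) (ht : t ∈ Set.Icc (0:ℝ) 1)
    (ha : a ∈ Set.Ico (-L / 2) (L / 2)) : ∃ i ∈ Finset.range (2 ^ k), idx L k t a = (i : ℤ) := by
  have h1 : -1 / 2 ≤ a / L := by rw [le_div_iff₀ hL]; linarith [ha.1]
  have h2 : a / L < 1 / 2 := by rw [div_lt_iff₀ hL]; linarith [ha.2]
  have hp : (0:ℝ) < 2 ^ k := by positivity
  have h3 : 0 ≤ idx L k t a := by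
    unfold idx
    apply Int.floor_nonneg.2
    apply mul_nonneg hp.le
    linarith [ht.1]
  have h4 : idx L k t a < 2 ^ k := by
    unfold idx
    rw [Int.floor_lt]
    push_cast
    have : (a / L + 1 / 2 + t) / 2 < 1 := by linarith [ht.2]
    nlinarith
  refine ⟨(idx L k t a).toNat, ?_, ?_⟩
  · rw [Finset.mem_range]
    zify
    rw [Int.toNat_of_nonneg h3]
    exact h4
  · rw [Int.toNat_of_nonneg h3]

/-- indicator of the cell -/
def cell (L : ℝ) (k : ℕ) (t : ℝ) (i j : ℕ) (x : Pl) : ℝ :=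
  if idx L k t (x 0) = i ∧ idx L k t (x 1) = j then 1 else 0

/-- indicator of being in the same cell -/
def same (L : ℝ) (k : ℕ) (t : ℝ) (x y : Pl) : ℝ :=
  if idx L k t (x 0) = idx L k t (y 0) ∧ idx L k t (x 1) = idx L k t (y 1) then 1 else 0

/-- the box -/
def box (L : ℝ) : Set Pl := {x | x 0 ∈ Set.Ico (-L / 2) (L / 2) ∧ x 1 ∈ Set.Ico (-L / 2) (L / 2)}

lemma cell_children (L : ℝ) (k : ℕ) (t : ℝ) (i j : ℕ) (x : Pl) :
    cell L k t i j x = cell L (k + 1) t (2 * i) (2 * j) x + cell L (k + 1) t (2 * i) (2 * j + 1) x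
      + cell L (k + 1) t (2 * i + 1) (2 * j) x + cell L (k + 1) t (2 * i + 1) (2 * j + 1) x := by
  unfold cell
  rw [idx_succ L k, idx_succ L k]
  generalize idx L (k + 1) t (x 0) = A
  generalize idx L (k + 1) t (x 1) = B
  push_cast
  rcases Int.emod_two_eq A with hA | hA <;> rcases Int.emod_two_eq B with hB | hB <;>
  by_cases h1 : A / 2 = i <;> by_cases h2 : B / 2 = j <;>
  · have a1 : (A = 2 * (i:ℤ)) ↔ (A / 2 = i ∧ A % 2 = 0) := by omega
    have a2 : (A = 2 * (i:ℤ) + 1) ↔ (A / 2 = i ∧ A % 2 = 1) := by omega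
    have a3 : (B = 2 * (j:ℤ)) ↔ (B / 2 = j ∧ B % 2 = 0) := by omega
    have a4 : (B = 2 * (j:ℤ) + 1) ↔ (B / 2 = j ∧ B % 2 = 1) := by omega
    simp only [a1, a2, a3, a4, h1, h2, hA, hB]
    norm_num

lemma cell_nonneg (L : ℝ) (k : ℕ) (t : ℝ) (i j : ℕ) (x : Pl) : 0 ≤ cell L k t i j x := by
  unfold cell; split_ifs <;> norm_num

lemma cell_le_one (L : ℝ) (k : ℕ) (t : ℝ) (i j : ℕ) (x : Pl) : cell L k t i j x ≤ 1 := by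
  unfold cell; split_ifs <;> norm_num

lemma lev_cell_mul (L : ℝ) (hL : 0 < L) (k : ℕ) (t : ℝ) (ht : t ∈ Set.Icc (0:ℝ) 1) (x y : Pl)
    (hx : x ∈ box L) : lev k (fun i j => cell L k t i j x * cell L k t i j y) = same L k t x y := by
  obtain ⟨i, hi, hi'⟩ := idx_range L hL k t _ ht hx.1
  obtain ⟨j, hj, hj'⟩ := idx_range L hL k t _ ht hx.2
  unfold lev
  rw [Finset.sum_eq_single_of_mem i hi, Finset.sum_eq_single_of_mem j hj]
  · unfold cell same
    rw [hi', hj']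
    simp [eq_comm]
  · intro b _ hb
    unfold cell
    beta_reduce
    rw [if_neg, zero_mul]
    rintro ⟨_, h⟩
    rw [hj'] at h
    exact hb (by exact_mod_cast h.symm)
  · intro b _ hb
    apply Finset.sum_eq_zero
    intro c _
    unfold cell
    beta_reduce
    rw [if_neg, zero_mul]
    rintro ⟨h, _⟩
    rw [hi'] at h
    exact hb (by exact_mod_cast h.symm)

lemma same_self (L : ℝ) (k : ℕ) (t : ℝ) (x : Pl) : same L k t x x = 1 := by simp [same]

lemma cell_mul_self (L : ℝ) (k : ℕ) (t : ℝ) (i j : ℕ) (x : Pl) :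
    cell L k t i j x * cell L k t i j x = cell L k t i j x := by
  unfold cell; split_ifs <;> norm_num

lemma lev_cell (L : ℝ) (hL : 0 < L) (k : ℕ) (t : ℝ) (ht : t ∈ Set.Icc (0:ℝ) 1) (x : Pl)
    (hx : x ∈ box L) : lev k (fun i j => cell L k t i j x) = 1 := by
  have := lev_cell_mul L hL k t ht x x hx
  simpa only [cell_mul_self, same_self] using this

lemma measurable_idx {α : Type*} [MeasurableSpace α] (L : ℝ) (k : ℕ) (g h : α → ℝ)
    (hg : Measurable g) (hh : Measurable h) : Measurable (fun p => idx L k (g p) (h p)) := by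
  unfold idx
  apply Measurable.floor
  fun_prop

lemma measurable_coord (i : Fin 2) : Measurable (fun x : Pl => x i) := by fun_prop

lemma measurable_cell (L : ℝ) (k : ℕ) (t : ℝ) (i j : ℕ) : Measurable (cell L k t i j) := by
  have h : ∀ (n : Fin 2) (i : ℤ), MeasurableSet {x : Pl | idx L k t (x n) = i} := fun n i =>
    measurable_idx L k (fun _ : Pl => t) _ measurable_const (measurable_coord n)
      (measurableSet_singleton i)
  unfold cell
  apply Measurable.ite _ measurable_const measurable_const
  exact (h 0 i).inter (h 1 j)

lemma measurable_same (L : ℝ) (k : ℕ) :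
    Measurable (fun p : ℝ × (Pl × Pl) => same L k p.1 p.2.1 p.2.2) := by
  have h1 : ∀ (n : Fin 2), Measurable (fun p : ℝ × (Pl × Pl) => idx L k p.1 (p.2.1 n)) := fun n =>
    measurable_idx L k _ _ measurable_fst
      ((measurable_coord n).comp (measurable_fst.comp measurable_snd))
  have h2 : ∀ (n : Fin 2), Measurable (fun p : ℝ × (Pl × Pl) => idx L k p.1 (p.2.2 n)) := fun n =>
    measurable_idx L k _ _ measurable_fst
      ((measurable_coord n).comp (measurable_snd.comp measurable_snd))
  have h : ∀ (n : Fin 2), MeasurableSet {p : ℝ × (Pl × Pl) |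
      idx L k p.1 (p.2.1 n) = idx L k p.1 (p.2.2 n)} := fun n =>
    measurableSet_eq_fun (h1 n) (h2 n)
  unfold same
  apply Measurable.ite _ measurable_const measurable_const
  exact (h 0).inter (h 1)

lemma cell_volume (L : ℝ) (hL : 0 < L) (k : ℕ) (t : ℝ) (i j : ℕ) :
    Integrable (cell L k t i j) ∧ ∫ x, cell L k t i j x = (2 * L / 2 ^ k) ^ 2 := by
  have hp : (0:ℝ) < 2 ^ k := by positivity
  set lo : ℕ → ℝ := fun i => L * (2 * i / 2 ^ k - 1 / 2 - t) with hlo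
  set hi : ℕ → ℝ := fun i => L * (2 * (i + 1) / 2 ^ k - 1 / 2 - t) with hhi
  have hidx : ∀ (a : ℝ) (i : ℕ), idx L k t a = (i:ℤ) ↔ a ∈ Set.Ico (lo i) (hi i) := by
    intro a i
    unfold idx
    rw [Int.floor_eq_iff, Set.mem_Ico]
    have e : a = L * (a / L) := by field_simp
    have e1 : lo i ≤ a ↔ 2 * (i:ℝ) / 2 ^ k - 1 / 2 - t ≤ a / L := by
      rw [le_div_iff₀ hL, mul_comm]
    have e2 : a < hi i ↔ a / L < 2 * ((i:ℝ) + 1) / 2 ^ k - 1 / 2 - t := by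
      rw [div_lt_iff₀ hL, mul_comm _ L]
    rw [e1, e2, sub_sub, sub_sub, sub_le_iff_le_add, lt_sub_iff_add_lt, div_le_iff₀ hp,
      lt_div_iff₀ hp]
    push_cast
    constructor <;> rintro ⟨h1, h2⟩ <;> constructor <;> nlinarith
  set v : Fin 2 → ℕ := ![i, j]
  set S : Set Pl := (MeasurableEquiv.toLp 2 (Fin 2 → ℝ)).symm ⁻¹'
    (Set.univ.pi fun n => Set.Ico (lo (v n)) (hi (v n))) with hS
  have hSm : MeasurableSet S :=
    (MeasurableEquiv.measurable _) (MeasurableSet.univ_pi fun n => measurableSet_Ico)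
  have hvol : volume S = ENNReal.ofReal ((2 * L / 2 ^ k) ^ 2) := by
    rw [hS, (EuclideanSpace.volume_preserving_symm_measurableEquiv_toLp (Fin 2)).measure_preimage
      (MeasurableSet.univ_pi fun n => measurableSet_Ico).nullMeasurableSet, Real.volume_pi_Ico]
    have : ∀ n, hi n - lo n = 2 * L / 2 ^ k := by
      intro n; simp only [hlo, hhi]; field_simp; ring
    simp only [this, Finset.prod_const, Finset.card_univ, Fintype.card_fin]
    rw [ENNReal.ofReal_pow (by positivity)]
  have hc : cell L k t i j = S.indicator (fun _ => 1) := by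
    ext x
    have : x ∈ S ↔ idx L k t (x 0) = i ∧ idx L k t (x 1) = j := by
      rw [hidx, hidx, hS]
      simp [Set.mem_pi, Fin.forall_fin_two, v]
    unfold cell
    by_cases hx : x ∈ S
    · rw [Set.indicator_of_mem hx, if_pos (this.1 hx)]
    · rw [Set.indicator_of_notMem hx, if_neg (fun h => hx (this.2 h))]
  rw [hc]
  constructor
  · rw [integrable_indicator_iff hSm]
    refine integrableOn_const ?_ (by simp)
    rw [hvol]; exact ENNReal.ofReal_ne_top
  · rw [integral_indicator hSm, setIntegral_const, Measure.real, hvol,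
      ENNReal.toReal_ofReal (by positivity)]
    simp

lemma integrable_mul_cell (L : ℝ) (k : ℕ) (t : ℝ) (i j : ℕ) (h : Pl → ℝ) (hi : Integrable h) :
    Integrable (fun x => h x * cell L k t i j x) := by
  apply hi.mul_bdd (c := 1) (measurable_cell L k t i j).aestronglyMeasurable
  filter_upwards with x
  rw [Real.norm_eq_abs, abs_of_nonneg (cell_nonneg _ _ _ _ _ _)]
  exact cell_le_one _ _ _ _ _ _

lemma cell_entropy (L : ℝ) (hL : 0 < L) (k : ℕ) (t : ℝ) (i j : ℕ) (h : Pl → ℝ) (h0 : ∀ x, 0 ≤ h x)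
    (hi : Integrable h) (hlog : Integrable (fun x => h x * log (h x))) :
    (∫ x, h x * cell L k t i j x) * log (∫ x, h x * cell L k t i j x) -
      (∫ x, h x * cell L k t i j x) * log ((2 * L / 2 ^ k) ^ 2) ≤
    ∫ x, h x * log (h x) * cell L k t i j x := by
  set μ := ∫ x, h x * cell L k t i j x with hμ
  set V := (2 * L / 2 ^ k) ^ 2 with hV
  have hVpos : 0 < V := by positivity
  obtain ⟨hc, hcV⟩ := cell_volume L hL k t i j
  have hhc := integrable_mul_cell L k t i j h hi
  have hnn : ∀ x, 0 ≤ h x * cell L k t i j x := fun x => mul_nonneg (h0 x) (cell_nonneg _ _ _ _ _ _)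
  have hμ0 : 0 ≤ μ := integral_nonneg hnn
  rcases hμ0.eq_or_lt with he | hpos
  · have hz := (integral_eq_zero_iff_of_nonneg hnn hhc).1 he.symm
    have : ∫ x, h x * log (h x) * cell L k t i j x = 0 := by
      apply integral_eq_zero_of_ae
      filter_upwards [hz] with x hx
      simp only [Pi.zero_apply] at hx ⊢
      rw [mul_right_comm, hx, zero_mul]
    rw [this, ← he]
    simp
  · have hb : 0 < μ / V := by positivity
    have hpt : ∀ x, log (μ / V) * (h x * cell L k t i j x) + h x * cell L k t i j x
        - (μ / V) * cell L k t i j x ≤ h x * log (h x) * cell L k t i j x := by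
      intro x
      have hx : h x * log (μ / V) + h x - μ / V ≤ h x * log (h x) := by
        rcases (h0 x).eq_or_lt with hx | hx
        · rw [← hx]; simp; positivity
        · have := log_le_sub_one_of_pos (show 0 < (μ / V) / h x by positivity)
          rw [log_div hb.ne' hx.ne'] at this
          have := mul_le_mul_of_nonneg_left this hx.le
          rw [mul_sub, mul_sub, mul_div_cancel₀ _ hx.ne'] at this
          linarith
      have := mul_le_mul_of_nonneg_right hx (cell_nonneg L k t i j x)
      linarith
    have i1 : Integrable (fun x => log (μ / V) * (h x * cell L k t i j x)
        + h x * cell L k t i j x) := (hhc.const_mul (log (μ / V))).add hhc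
    have := integral_mono (i1.sub (hc.const_mul (μ / V)))
      (integrable_mul_cell L k t i j _ hlog) hpt
    simp only [Pi.sub_apply] at this
    rw [integral_sub i1 (hc.const_mul (μ / V)),
      integral_add (hhc.const_mul (log (μ / V))) hhc, integral_const_mul, integral_const_mul, hcV,
      ← hμ, div_mul_cancel₀ _ hVpos.ne', log_div hpos.ne' hVpos.ne'] at this
    linarith

lemma integrable_hh_same (L : ℝ) (k : ℕ) (t : ℝ) (h : Pl → ℝ) (hi : Integrable h) :
    Integrable (fun q : Pl × Pl => h q.1 * h q.2 * same L k t q.1 q.2) := by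
  apply (hi.mul_prod hi).mul_bdd (c := 1)
  · exact ((measurable_same L k).comp (measurable_prodMk_left (x := t))).aestronglyMeasurable
  · filter_upwards with x
    unfold same
    split_ifs <;> simp

lemma lev_integral {α : Type*} [MeasurableSpace α] (μ : Measure α) (k : ℕ) (F : ℕ → ℕ → α → ℝ)
    (hF : ∀ i j, Integrable (F i j) μ) :
    lev k (fun i j => ∫ x, F i j x ∂μ) = ∫ x, lev k (fun i j => F i j x) ∂μ := by
  unfold lev
  rw [integral_finsetSum _ (fun i _ => integrable_finsetSum _ (fun j _ => hF i j))]
  apply Finset.sum_congr rfl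
  intro i _
  rw [integral_finsetSum _ (fun j _ => hF i j)]

lemma fixed_t (L : ℝ) (hL : 0 < L) (h : Pl → ℝ) (h0 : ∀ x, 0 ≤ h x) (hi : Integrable h)
    (hs : ∀ x, x ∉ box L → h x = 0) (hlog : Integrable (fun x => h x * log (h x)))
    (m : ℝ) (hm : ∫ x, h x = m) (hm0 : 0 < m) (t : ℝ) (ht : t ∈ Set.Icc (0:ℝ) 1) (K : ℕ) :
    2 * log 2 / m * (∑ k ∈ Finset.range K,
        ∫ q : Pl × Pl, h q.1 * h q.2 * same L (k + 1) t q.1 q.2)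
      - 3 * m + m * log m - 2 * m * log (2 * L) ≤ ∫ x, h x * log (h x) := by
  have hic := fun k i j => integrable_mul_cell L k t i j h hi
  set w : ℕ → ℕ → ℕ → ℝ := fun k i j => ∫ x, h x * cell L k t i j x with hw
  have w0 : ∀ k i j, 0 ≤ w k i j := fun k i j =>
    integral_nonneg fun x => mul_nonneg (h0 x) (cell_nonneg _ _ _ _ _ _)
  have w1 : ∀ k i j, w k i j ≤ m := by
    intro k i j
    rw [← hm]
    apply integral_mono (hic k i j) hi
    intro x
    exact mul_le_of_le_one_right (h0 x) (cell_le_one _ _ _ _ _ _)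
  have wc : ∀ k i j, w k i j = w (k + 1) (2 * i) (2 * j) + w (k + 1) (2 * i) (2 * j + 1)
      + w (k + 1) (2 * i + 1) (2 * j) + w (k + 1) (2 * i + 1) (2 * j + 1) := by
    intro k i j
    simp only [hw]
    have e : ∀ x, h x * cell L k t i j x = h x * cell L (k + 1) t (2 * i) (2 * j) x
        + h x * cell L (k + 1) t (2 * i) (2 * j + 1) x
        + h x * cell L (k + 1) t (2 * i + 1) (2 * j) x
        + h x * cell L (k + 1) t (2 * i + 1) (2 * j + 1) x := by
      intro x
      rw [cell_children]
      ring
    simp only [e]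
    have i1 : Integrable (fun x => h x * cell L (k + 1) t (2 * i) (2 * j) x
        + h x * cell L (k + 1) t (2 * i) (2 * j + 1) x) := (hic _ _ _).add (hic _ _ _)
    have i2 : Integrable (fun x => h x * cell L (k + 1) t (2 * i) (2 * j) x
        + h x * cell L (k + 1) t (2 * i) (2 * j + 1) x
        + h x * cell L (k + 1) t (2 * i + 1) (2 * j) x) := i1.add (hic _ _ _)
    rw [integral_add i2 (hic _ _ _), integral_add i1 (hic _ _ _),
      integral_add (hic _ _ _) (hic _ _ _)]
  have wtot : ∀ k, lev k (fun i j => w k i j) = m := by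
    intro k
    simp only [hw]
    rw [lev_integral _ _ _ (fun i j => hic k i j), ← hm]
    congr 1
    ext x
    rw [lev_mul]
    by_cases hx : x ∈ box L
    · rw [lev_cell L hL k t ht x hx, mul_one]
    · rw [hs x hx, zero_mul]
  have w00 : w 0 0 0 = m := by
    have := wtot 0
    simpa [lev] using this
  have T := tree (fun k i j => w k i j / m) (fun k i j => div_nonneg (w0 _ _ _) hm0.le)
    (fun k i j => (div_le_one hm0).2 (w1 _ _ _))
    (fun k i j => by rw [wc k i j]; ring) (by simp only [w00]; exact div_self hm0.ne') K
  have sq : ∀ k, lev k (fun i j => (w k i j / m) ^ 2) =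
      (1 / m ^ 2) * ∫ q : Pl × Pl, h q.1 * h q.2 * same L k t q.1 q.2 := by
    intro k
    have e1 : ∀ i j, (w k i j / m) ^ 2 = (1 / m ^ 2) *
        ∫ q : Pl × Pl, (h q.1 * cell L k t i j q.1) * (h q.2 * cell L k t i j q.2) := by
      intro i j
      have := integral_prod_mul (μ := (volume : Measure Pl)) (ν := (volume : Measure Pl))
        (fun x => h x * cell L k t i j x) (fun x => h x * cell L k t i j x)
      rw [← Measure.volume_eq_prod] at this
      rw [this]
      simp only [hw]
      ring
    simp only [e1]
    rw [lev_mul, lev_integral volume _ _ (fun i j => (hic k i j).mul_prod (hic k i j))]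
    congr 2
    ext q
    have e2 : ∀ i j, (h q.1 * cell L k t i j q.1) * (h q.2 * cell L k t i j q.2) =
      (h q.1 * h q.2) * (cell L k t i j q.1 * cell L k t i j q.2) := by intro i j; ring
    simp only [e2]
    rw [lev_mul]
    by_cases hx : q.1 ∈ box L
    · rw [lev_cell_mul L hL k t ht q.1 q.2 hx]
    · rw [hs _ hx]; simp
  have ent : lev K (fun i j => w K i j * log (w K i j) +
      (-log ((2 * L / 2 ^ K) ^ 2)) * w K i j) ≤ ∫ x, h x * log (h x) := by
    calc _ ≤ lev K (fun i j => ∫ x, h x * log (h x) * cell L K t i j x) := by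
          apply lev_mono
          intro i j
          have := cell_entropy L hL K t i j h h0 hi hlog
          simp only [hw]
          linarith
      _ = ∫ x, h x * log (h x) := by
          rw [lev_integral _ _ _ (fun i j => integrable_mul_cell L K t i j _ hlog)]
          congr 1
          ext x
          rw [lev_mul]
          by_cases hx : x ∈ box L
          · rw [lev_cell L hL K t ht x hx, mul_one]
          · rw [hs x hx]; simp
  rw [lev_add, lev_mul, wtot] at ent
  have norm : lev K (fun i j => w K i j / m * log (w K i j / m)) =
      (1 / m) * lev K (fun i j => w K i j * log (w K i j)) - log m := by
    have e : ∀ i j, w K i j / m * log (w K i j / m) =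
        (1 / m) * (w K i j * log (w K i j)) + (-log m / m) * w K i j := by
      intro i j
      rcases (w0 K i j).eq_or_lt with h | h
      · rw [← h]; simp
      · rw [log_div h.ne' hm0.ne']; ring
    simp only [e]
    rw [lev_add, lev_mul, lev_mul, wtot]
    field_simp
    ring
  have hV : log ((2 * L / 2 ^ K) ^ 2) = 2 * log (2 * L) - 2 * K * log 2 := by
    rw [log_pow, log_div (by positivity) (by positivity), log_pow]
    push_cast; ring
  rw [hV] at ent
  rw [norm] at T
  simp only [sq] at T
  rw [← Finset.mul_sum] at T
  set I := ∑ k ∈ Finset.range K, ∫ q : Pl × Pl, h q.1 * h q.2 * same L (k + 1) t q.1 q.2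
  have T2 := mul_le_mul_of_nonneg_left T hm0.le
  have e3 : m * (2 * log 2 * (1 / m ^ 2 * I) - 3) = 2 * log 2 / m * I - 3 * m := by
    field_simp
  have e4 : m * (1 / m * lev K (fun i j => w K i j * log (w K i j)) - log m + 2 * log 2 * K) =
      lev K (fun i j => w K i j * log (w K i j)) - m * log m + 2 * log 2 * K * m := by
    field_simp
  rw [e3, e4] at T2
  linarith

lemma same_nonneg (L : ℝ) (k : ℕ) (t : ℝ) (x y : Pl) : 0 ≤ same L k t x y := by
  unfold same; split_ifs <;> norm_num

lemma same_norm_le (L : ℝ) (k : ℕ) (t : ℝ) (x y : Pl) : ‖same L k t x y‖ ≤ 1 := by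
  unfold same; split_ifs <;> simp

lemma idx_eq (L : ℝ) (k : ℕ) (t a : ℝ) :
    idx L (k + 1) t a = ⌊((2 ^ k : ℕ) : ℝ) * ((a / L + 1 / 2) + t)⌋ := by
  unfold idx
  congr 1
  push_cast
  ring

lemma same_avg (L : ℝ) (hL : 0 < L) (k : ℕ) (x y : Pl) :
    max 0 (1 - 2 * (2 ^ (k + 1) * (‖x - y‖ / (2 * L)))) ≤
      ∫ t in Set.Ioc (0:ℝ) 1, same L (k + 1) t x y := by
  apply max_le
  · exact integral_nonneg fun t => same_nonneg _ _ _ _ _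
  · rw [← intervalIntegral.integral_of_le zero_le_one]
    have hm : Measurable (fun t : ℝ => same L (k + 1) t x y) := by
      have h2 : Measurable (fun t : ℝ => (t, ((x, y) : Pl × Pl))) := measurable_prodMk_right
      have h3 := (measurable_same L (k + 1)).comp h2
      simpa only [Function.comp_def] using h3
    have hsi : IntervalIntegrable (fun t : ℝ => same L (k + 1) t x y) volume 0 1 := by
      rw [intervalIntegrable_iff]
      apply Measure.integrableOn_of_bounded (M := 1)
      · simp
      · exact hm.aestronglyMeasurable
      · filter_upwards with t using same_norm_le _ _ _ _ _
    obtain ⟨i0, e0⟩ := floor_shift_abs (2 ^ k) (y 0 / L + 1 / 2) (x 0 / L + 1 / 2)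
    obtain ⟨i1, e1⟩ := floor_shift_abs (2 ^ k) (y 1 / L + 1 / 2) (x 1 / L + 1 / 2)
    have hc : IntervalIntegrable (fun _ : ℝ => (1:ℝ)) volume 0 1 := by simp
    have hle := intervalIntegral.integral_mono_on zero_le_one ((hc.sub i0).sub i1) hsi (by
      intro t _
      show 1 - |_| - |_| ≤ _
      unfold same
      rw [idx_eq, idx_eq, idx_eq, idx_eq]
      have key : ∀ A B : ℤ, A ≠ B → (1:ℝ) ≤ |(A:ℝ) - B| := by
        intro A B hAB
        have : 1 ≤ |A - B| := Int.one_le_abs (sub_ne_zero.2 hAB)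
        exact_mod_cast this
      generalize ⌊((2 ^ k : ℕ) : ℝ) * ((x 0 / L + 1 / 2) + t)⌋ = A
      generalize ⌊((2 ^ k : ℕ) : ℝ) * ((y 0 / L + 1 / 2) + t)⌋ = B
      generalize ⌊((2 ^ k : ℕ) : ℝ) * ((x 1 / L + 1 / 2) + t)⌋ = C
      generalize ⌊((2 ^ k : ℕ) : ℝ) * ((y 1 / L + 1 / 2) + t)⌋ = D
      have a1 := abs_nonneg ((A:ℝ) - B)
      have a2 := abs_nonneg ((C:ℝ) - D)
      split_ifs with hh
      · linarith
      · by_cases hAB : A = B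
        · have := key C D (fun h => hh ⟨hAB, h⟩)
          linarith
        · have := key A B hAB
          linarith)
    rw [intervalIntegral.integral_sub (hc.sub i0) i1, intervalIntegral.integral_sub hc i0,
      e0, e1, intervalIntegral.integral_const, sub_zero, one_smul] at hle
    refine le_trans ?_ hle
    have nb : ∀ i : Fin 2, |(x i / L + 1 / 2) - (y i / L + 1 / 2)| ≤ ‖x - y‖ / L := by
      intro i
      rw [show (x i / L + 1 / 2) - (y i / L + 1 / 2) = (x i - y i) / L by ring, abs_div,
        abs_of_pos hL]
      have := PiLp.norm_apply_le (x - y) i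
      rw [PiLp.sub_apply, Real.norm_eq_abs] at this
      gcongr
    have hp : (0:ℝ) ≤ ((2 ^ k : ℕ) : ℝ) := by positivity
    have n0 := mul_le_mul_of_nonneg_left (nb 0) hp
    have n1 := mul_le_mul_of_nonneg_left (nb 1) hp
    have : 2 * (2 ^ (k + 1) * (‖x - y‖ / (2 * L))) = 2 * (((2 ^ k : ℕ) : ℝ) * (‖x - y‖ / L)) := by
      push_cast
      rw [pow_succ]
      field_simp
    rw [this]
    linarith

lemma avg_sum (L : ℝ) (hL : 0 < L) (K : ℕ) (x y : Pl) (hx : x ∈ box L) (hy : y ∈ box L) :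
    min (K * log 2 - log (2 * L)) (-log ‖x - y‖) + log (2 * L) - 8 * log 2 ≤
    log 2 * ∑ k ∈ Finset.range K, ∫ t in Set.Ioc (0:ℝ) 1, same L (k + 1) t x y := by
  have hl : 0 < log 2 := log_pos (by norm_num)
  have h1 : log 2 * ∑ k ∈ Finset.range K, max 0 (1 - 2 * (2 ^ (k + 1) * (‖x - y‖ / (2 * L)))) ≤
    log 2 * ∑ k ∈ Finset.range K, ∫ t in Set.Ioc (0:ℝ) 1, same L (k + 1) t x y :=
    mul_le_mul_of_nonneg_left (Finset.sum_le_sum fun k _ => same_avg L hL k x y) hl.le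
  refine le_trans ?_ h1
  rcases (norm_nonneg (x - y)).eq_or_lt with h0 | h0
  · rw [← h0]
    have := min_le_left (K * log 2 - log (2 * L)) 0
    simp
    linarith
  · have hd : ‖x - y‖ ≤ 2 * L := by
      rw [EuclideanSpace.norm_eq, Real.sqrt_le_left (by positivity)]
      simp only [Fin.sum_univ_two, PiLp.sub_apply, Real.norm_eq_abs, sq_abs]
      have b0 : |x 0 - y 0| ≤ L := by
        rw [abs_le]; constructor <;> linarith [hx.1.1, hx.1.2, hy.1.1, hy.1.2]
      have b1 : |x 1 - y 1| ≤ L := by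
        rw [abs_le]; constructor <;> linarith [hx.2.1, hx.2.2, hy.2.1, hy.2.2]
      nlinarith [sq_le_sq' (abs_le.1 b0).1 (abs_le.1 b0).2,
        sq_le_sq' (abs_le.1 b1).1 (abs_le.1 b1).2]
    have hr : 0 < ‖x - y‖ / (2 * L) := by positivity
    have := geom_bound K (‖x - y‖ / (2 * L)) hr (by
      rw [div_le_iff₀ (by positivity)]; linarith)
    have h2 : min (K * log 2) (-log (‖x - y‖ / (2 * L))) =
      min (K * log 2 - log (2 * L)) (-log ‖x - y‖) + log (2 * L) := by
      rw [← min_add_add_right, log_div h0.ne' (by positivity)]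
      congr 1 <;> ring
    rw [h2] at this
    have : 0 ≤ 4 * log 2 * (‖x - y‖ / (2 * L)) := by positivity
    linarith

lemma averaged (L : ℝ) (hL : 0 < L) (h : Pl → ℝ) (h0 : ∀ x, 0 ≤ h x) (hi : Integrable h)
    (hs : ∀ x, x ∉ box L → h x = 0) (hlog : Integrable (fun x => h x * log (h x)))
    (m : ℝ) (hm : ∫ x, h x = m) (hm0 : 0 < m) (K : ℕ)
    (hmin : Integrable (fun q : Pl × Pl => h q.1 * h q.2 *
      min (K * log 2 - log (2 * L)) (-log ‖q.1 - q.2‖))) :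
    2 / m * (∫ q : Pl × Pl, h q.1 * h q.2 * min (K * log 2 - log (2 * L)) (-log ‖q.1 - q.2‖))
      - (16 * log 2 + 3) * m + m * log m ≤ ∫ x, h x * log (h x) := by
  set τ : Measure ℝ := volume.restrict (Set.Ioc (0:ℝ) 1) with hτ
  have : IsProbabilityMeasure τ := ⟨by simp [hτ]⟩
  have hhi : Integrable (fun q : Pl × Pl => h q.1 * h q.2) := hi.mul_prod hi
  have hhm : ∫ q : Pl × Pl, h q.1 * h q.2 = m ^ 2 := by
    rw [Measure.volume_eq_prod, integral_prod_mul h h, hm]; ring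
  have hI : ∀ k, Integrable (fun p : ℝ × (Pl × Pl) =>
      h p.2.1 * h p.2.2 * same L k p.1 p.2.1 p.2.2) (τ.prod volume) := by
    intro k
    apply (hhi.comp_snd τ).mul_bdd (c := 1) (measurable_same L k).aestronglyMeasurable
    filter_upwards with p using same_norm_le _ _ _ _ _
  have hIt : ∀ k, Integrable (fun t : ℝ =>
      ∫ q : Pl × Pl, h q.1 * h q.2 * same L k t q.1 q.2) τ := fun k => (hI k).integral_prod_left
  have hIq : ∀ k, Integrable (fun q : Pl × Pl => h q.1 * h q.2 *
      ∫ t, same L k t q.1 q.2 ∂τ) := by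
    intro k
    have := (hI k).integral_prod_right
    simpa only [integral_const_mul] using this
  have swap : ∀ k, ∫ t, (∫ q : Pl × Pl, h q.1 * h q.2 * same L k t q.1 q.2) ∂τ =
      ∫ q : Pl × Pl, h q.1 * h q.2 * ∫ t, same L k t q.1 q.2 ∂τ := by
    intro k
    rw [integral_integral_swap (hI k)]
    simp only [integral_const_mul]
  set c := K * log 2 - log (2 * L)
  set I : ℝ → ℝ := fun t => ∑ k ∈ Finset.range K,
        ∫ q : Pl × Pl, h q.1 * h q.2 * same L (k + 1) t q.1 q.2 with hIdef
  have hIint : Integrable I τ := integrable_finsetSum _ fun k _ => hIt (k + 1)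
  have step1 : 2 * log 2 / m * (∫ t, I t ∂τ) + (- 3 * m + m * log m - 2 * m * log (2 * L)) ≤
      ∫ x, h x * log (h x) := by
    have e : ∫ t, (2 * log 2 / m * I t + (- 3 * m + m * log m - 2 * m * log (2 * L))) ∂τ =
      2 * log 2 / m * (∫ t, I t ∂τ) + (- 3 * m + m * log m - 2 * m * log (2 * L)) := by
      rw [integral_add (hIint.const_mul _) (integrable_const _), integral_const_mul]
      simp
    have e' : ∫ t, (∫ x, h x * log (h x)) ∂τ = ∫ x, h x * log (h x) := by simp
    rw [← e, ← e']
    apply integral_mono_ae ((hIint.const_mul _).add (integrable_const _)) (integrable_const _)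
    filter_upwards [ae_restrict_mem measurableSet_Ioc] with t ht
    have := fixed_t L hL h h0 hi hs hlog m hm hm0 t ⟨ht.1.le, ht.2⟩ K
    simp only [hIdef, Pi.add_apply]
    linarith
  have step2 : (∫ q : Pl × Pl, h q.1 * h q.2 * min c (-log ‖q.1 - q.2‖)) +
      (log (2 * L) - 8 * log 2) * m ^ 2 ≤ log 2 * (∫ t, I t ∂τ) := by
    rw [hIdef, integral_finsetSum _ (fun k _ => hIt (k + 1))]
    simp only [swap]
    rw [← integral_finsetSum _ (fun k _ => hIq (k + 1)), ← hhm, ← integral_const_mul,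
      ← integral_const_mul, ← integral_add hmin (hhi.const_mul _)]
    apply integral_mono (hmin.add (hhi.const_mul _))
      ((integrable_finsetSum _ fun k _ => hIq (k + 1)).const_mul _)
    intro q
    simp only [Pi.add_apply]
    by_cases hx : q.1 ∈ box L
    · by_cases hy : q.2 ∈ box L
      · have := avg_sum L hL K q.1 q.2 hx hy
        have := mul_le_mul_of_nonneg_left this (mul_nonneg (h0 q.1) (h0 q.2))
        rw [← Finset.mul_sum]
        linarith
      · simp [hs _ hy]
    · simp [hs _ hx]
  have step3 := mul_le_mul_of_nonneg_left step2 (show 0 ≤ 2 / m by positivity)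
  have e1 : 2 / m * (log 2 * ∫ t, I t ∂τ) = 2 * log 2 / m * ∫ t, I t ∂τ := by ring
  have e2 : 2 / m * ((∫ q : Pl × Pl, h q.1 * h q.2 * min c (-log ‖q.1 - q.2‖)) +
      (log (2 * L) - 8 * log 2) * m ^ 2) = 
      2 / m * (∫ q : Pl × Pl, h q.1 * h q.2 * min c (-log ‖q.1 - q.2‖)) +
      2 * (log (2 * L) - 8 * log 2) * m := by
    field_simp
  rw [e1, e2] at step3
  linarith

lemma measurableSet_box (L : ℝ) : MeasurableSet (box L) :=
  (measurable_coord 0 measurableSet_Ico).inter (measurable_coord 1 measurableSet_Ico)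

lemma eventually_box (x : Pl) : ∀ᶠ n : ℕ in Filter.atTop, x ∈ box ((2:ℝ) ^ n) := by
  have h := (tendsto_pow_atTop_atTop_of_one_lt (r := (2:ℝ)) (by norm_num))
  filter_upwards [h.eventually_gt_atTop (2 * |x 0|), h.eventually_gt_atTop (2 * |x 1|)] with n h0 h1
  have a0 := abs_lt.1 (show |x 0| < (2:ℝ) ^ n / 2 by linarith)
  have a1 := abs_lt.1 (show |x 1| < (2:ℝ) ^ n / 2 by linarith)
  refine ⟨⟨?_, a0.2⟩, ⟨?_, a1.2⟩⟩ <;> linarith [a0.1, a1.1]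

lemma abs_min_le (c v : ℝ) (hc : 0 ≤ c) : |min c (-v)| ≤ |v| := by
  rw [abs_le]
  constructor
  · apply le_min
    · linarith [abs_nonneg v]
    · linarith [le_abs_self v]
  · exact (min_le_right _ _).trans (neg_le_abs v)

lemma log_hls (M : ℝ) (hM0 : 0 < M) (f : Pl → ℝ) (h0 : ∀ x, 0 ≤ f x) (hi : Integrable f)
    (hM : ∫ x, f x = M) (hlog : Integrable (fun x => f x * |log (f x)|))
    (hint : Integrable (fun q : Pl × Pl => f q.1 * f q.2 * |log ‖q.1 - q.2‖|)) :
    2 / M * (∫ q : Pl × Pl, f q.1 * f q.2 * (-log ‖q.1 - q.2‖))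
      - (16 * log 2 + 3) * M + M * log M ≤ ∫ x, f x * log (f x) := by
  have hl : 0 < log 2 := log_pos (by norm_num)
  have hlog' : Integrable (fun x => f x * log (f x)) := by
    apply hlog.mono
    · exact hi.aestronglyMeasurable.mul
        (measurable_log.comp_aemeasurable hi.aestronglyMeasurable.aemeasurable).aestronglyMeasurable
    · filter_upwards with x
      simp
  have hhi : Integrable (fun q : Pl × Pl => f q.1 * f q.2) := hi.mul_prod hi
  have hmeas : Measurable (fun q : Pl × Pl => log ‖q.1 - q.2‖) :=
    measurable_log.comp (measurable_fst.sub measurable_snd).norm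
  set h : ℕ → Pl → ℝ := fun n => (box ((2:ℝ) ^ n)).indicator f with hh
  have hn0 : ∀ n x, 0 ≤ h n x := fun n x => Set.indicator_nonneg (fun x _ => h0 x) x
  have hnle : ∀ n x, h n x ≤ f x := fun n x => Set.indicator_le_self' (fun x _ => h0 x) x
  have hev : ∀ x, ∀ᶠ n in Filter.atTop, h n x = f x := by
    intro x
    filter_upwards [eventually_box x] with n hn
    exact Set.indicator_of_mem hn f
  have hni : ∀ n, Integrable (h n) := fun n => hi.indicator (measurableSet_box _)
  have hloge : ∀ n, (fun x => h n x * log (h n x)) =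
      (box ((2:ℝ) ^ n)).indicator (fun x => f x * log (f x)) := by
    intro n
    ext x
    by_cases hx : x ∈ box ((2:ℝ) ^ n) <;> simp [hh, hx]
  have hnlog : ∀ n, Integrable (fun x => h n x * log (h n x)) := by
    intro n
    rw [hloge]
    exact hlog'.indicator (measurableSet_box _)
  set c : ℕ → ℝ := fun n => ((3 * n + 1 : ℕ) : ℝ) * log 2 - log (2 * (2:ℝ) ^ n) with hc
  have hceq : ∀ n, c n = 2 * n * log 2 := by
    intro n
    simp only [hc]
    rw [log_mul (by norm_num) (by positivity), log_pow]
    push_cast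
    ring
  have hc0 : ∀ n, 0 ≤ c n := fun n => by rw [hceq]; positivity
  have hct : Filter.Tendsto c Filter.atTop Filter.atTop := by
    have : c = fun n : ℕ => (n:ℝ) * (2 * log 2) := by ext n; rw [hceq]; ring
    rw [this]
    exact tendsto_natCast_atTop_atTop.atTop_mul_const (by positivity)
  have hmm : ∀ n, AEStronglyMeasurable
      (fun q : Pl × Pl => h n q.1 * h n q.2 * min (c n) (-log ‖q.1 - q.2‖)) := fun n =>
    ((hni n).mul_prod (hni n)).aestronglyMeasurable.mul
      (measurable_const.min hmeas.neg).aestronglyMeasurable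
  have hbd : ∀ n, ∀ q : Pl × Pl, ‖h n q.1 * h n q.2 * min (c n) (-log ‖q.1 - q.2‖)‖ ≤
      f q.1 * f q.2 * |log ‖q.1 - q.2‖| := by
    intro n q
    rw [norm_mul, Real.norm_eq_abs, Real.norm_eq_abs,
      abs_of_nonneg (mul_nonneg (hn0 n q.1) (hn0 n q.2))]
    exact mul_le_mul (mul_le_mul (hnle _ _) (hnle _ _) (hn0 _ _) (h0 _))
      (abs_min_le _ _ (hc0 n)) (abs_nonneg _) (mul_nonneg (h0 _) (h0 _))
  have t1 : Filter.Tendsto (fun n => ∫ x, h n x) Filter.atTop (nhds M) := by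
    rw [← hM]
    apply tendsto_integral_of_dominated_convergence f (fun n => (hni n).aestronglyMeasurable) hi
    · intro n
      filter_upwards with x
      rw [Real.norm_eq_abs, abs_of_nonneg (hn0 n x)]
      exact hnle n x
    · filter_upwards with x
      exact tendsto_nhds_of_eventually_eq (hev x)
  have t2 : Filter.Tendsto (fun n => ∫ x, h n x * log (h n x)) Filter.atTop
      (nhds (∫ x, f x * log (f x))) := by
    apply tendsto_integral_of_dominated_convergence (fun x => ‖f x * log (f x)‖)
      (fun n => (hnlog n).aestronglyMeasurable) hlog'.norm
    · intro n
      filter_upwards with x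
      have := congrFun (hloge n) x
      rw [this]
      exact norm_indicator_le_norm_self _ _
    · filter_upwards with x
      apply tendsto_nhds_of_eventually_eq
      filter_upwards [hev x] with n hn
      rw [hn]
  have t3 : Filter.Tendsto (fun n => ∫ q : Pl × Pl,
      h n q.1 * h n q.2 * min (c n) (-log ‖q.1 - q.2‖)) Filter.atTop
      (nhds (∫ q : Pl × Pl, f q.1 * f q.2 * (-log ‖q.1 - q.2‖))) := by
    apply tendsto_integral_of_dominated_convergence _ hmm hint
    · intro n
      filter_upwards with q using hbd n q
    · filter_upwards with q
      apply tendsto_nhds_of_eventually_eq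
      filter_upwards [hev q.1, hev q.2, hct.eventually_ge_atTop (-log ‖q.1 - q.2‖)] with n a1 a2 a3
      rw [a1, a2, min_eq_right a3]
  have tL : Filter.Tendsto (fun n => 2 / (∫ x, h n x) * (∫ q : Pl × Pl,
      h n q.1 * h n q.2 * min (c n) (-log ‖q.1 - q.2‖)) - (16 * log 2 + 3) * (∫ x, h n x)
      + (∫ x, h n x) * log (∫ x, h n x)) Filter.atTop
      (nhds (2 / M * (∫ q : Pl × Pl, f q.1 * f q.2 * (-log ‖q.1 - q.2‖))
      - (16 * log 2 + 3) * M + M * log M)) :=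
    (((tendsto_const_nhds.div t1 hM0.ne').mul t3).sub (t1.const_mul _)).add
      (t1.mul (t1.log hM0.ne'))
  apply le_of_tendsto_of_tendsto tL t2
  filter_upwards [t1.eventually (lt_mem_nhds hM0)] with n hn
  exact averaged ((2:ℝ) ^ n) (by positivity) (h n) (hn0 n) (hni n)
    (fun x hx => Set.indicator_of_notMem hx f) (hnlog n) _ rfl hn (3 * n + 1)
    (hint.mono' (hmm n) (Filter.Eventually.of_forall (hbd n)))

/-- For `M ∈ (0, 8π)` there is a constant `C₄ = C₄(M)` such that every nonnegative
integrable `f` on `ℝ²` of mass `M` with finite entropy and absolutely convergent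
interaction integral satisfies `∫ f log f ≤ (1 - M/(8π))⁻¹ F(f) + C₄`, where
`F(f) = ∫ f log f + (1/(4π)) ∬ f(x) f(y) log|x-y| dx dy` is the free energy. -/
theorem entropy_bound_by_free_energy (M : ℝ) (hM0 : 0 < M) (hM : M < 8 * π) :
    ∃ C₄ : ℝ,
      ∀ f : EuclideanSpace ℝ (Fin 2) → ℝ,
        (∀ x, 0 ≤ f x) → Integrable f → (∫ x, f x) = M →
        Integrable (fun x => f x * |Real.log (f x)|) →
        Integrable (fun q : EuclideanSpace ℝ (Fin 2) × EuclideanSpace ℝ (Fin 2) =>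
          f q.1 * f q.2 * |Real.log ‖q.1 - q.2‖|) →
        ∫ x, f x * Real.log (f x) ≤
          (1 - M / (8 * π))⁻¹ *
            ((∫ x, f x * Real.log (f x)) +
              (1 / (4 * π)) *
                ∫ q : EuclideanSpace ℝ (Fin 2) × EuclideanSpace ℝ (Fin 2),
                  f q.1 * f q.2 * Real.log ‖q.1 - q.2‖) + C₄ := by
  have hpi := Real.pi_pos
  have hθ : 0 < 1 - M / (8 * π) := by
    rw [sub_pos, div_lt_one (by positivity)]
    exact hM
  refine ⟨(1 - M / (8 * π))⁻¹ * (M / (8 * π) * ((16 * log 2 + 3) * M - M * log M)), ?_⟩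
  intro f h0 hi hmass hlog hint
  have key := log_hls M hM0 f h0 hi hmass hlog hint
  have e : ∫ q : Pl × Pl, f q.1 * f q.2 * (-log ‖q.1 - q.2‖) =
      -∫ q : Pl × Pl, f q.1 * f q.2 * log ‖q.1 - q.2‖ := by
    rw [← integral_neg]
    simp only [mul_neg]
  rw [e] at key
  set A := ∫ x, f x * Real.log (f x)
  set B := ∫ q : Pl × Pl, f q.1 * f q.2 * Real.log ‖q.1 - q.2‖
  rw [← mul_add, inv_mul_eq_div, le_div_iff₀ hθ]
  have k2 := mul_le_mul_of_nonneg_left key (show 0 ≤ M / (8 * π) by positivity)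
  have e2 : M / (8 * π) * (2 / M * -B - (16 * log 2 + 3) * M + M * log M) =
      -(1 / (4 * π) * B) - M / (8 * π) * ((16 * log 2 + 3) * M - M * log M) := by
    field_simp
    ring
  rw [e2] at k2
  linarith
end
end

section
/- Every nonnegative integrable function f on ℝ² with mass M := ∫_{ℝ²} f dx, finite second moment ∫_{ℝ²} f |x|² dx, and ∫ f |log f| dx < ∞ satisfies ∫_{ℝ²} f (log f)₊ dx ≤ ∫_{ℝ²} f log f dx + (1/4) ∫_{ℝ²} f(x) |x|² dx + 2M log(2π) + 2/e. -/
open MeasureTheory Real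

noncomputable section

/-- Every nonnegative integrable `f` on `ℝ²` with finite second moment and finite
entropy satisfies `∫ f (log f)₊ ≤ ∫ f log f + (1/4) ∫ f |x|² + 2M log(2π) + 2/e`,
where `M := ∫ f` is the mass. -/
theorem positive_entropy_bound (f : EuclideanSpace ℝ (Fin 2) → ℝ)
    (hf : ∀ x, 0 ≤ f x) (hint : Integrable f)
    (h2 : Integrable (fun x => f x * ‖x‖ ^ 2))
    (hlog : Integrable (fun x => f x * |Real.log (f x)|)) :
    ∫ x, f x * max (Real.log (f x)) 0 ≤
      (∫ x, f x * Real.log (f x)) + (1 / 4) * (∫ x, f x * ‖x‖ ^ 2) +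
        2 * (∫ x, f x) * Real.log (2 * π) + 2 / Real.exp 1 := by
  set g : EuclideanSpace ℝ (Fin 2) → ℝ :=
    fun x => (1 / (2 * π * Real.exp 1)) * Real.exp (-(1 / 4 : ℝ) * ‖x‖ ^ 2) with hg
  have hpi := Real.pi_pos
  have he := Real.exp_pos 1
  have hI : ∫ x : EuclideanSpace ℝ (Fin 2), Real.exp (-(1 / 4 : ℝ) * ‖x‖ ^ 2) = 4 * π := by
    rw [GaussianFourier.integral_rexp_neg_mul_sq_norm (by norm_num)]
    simp
    ring
  have hgint0 : Integrable (fun x : EuclideanSpace ℝ (Fin 2) =>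
      Real.exp (-(1 / 4 : ℝ) * ‖x‖ ^ 2)) := by
    by_contra h
    rw [integral_undef h] at hI
    linarith
  have hgint : Integrable g := hgint0.const_mul _
  have hgI : ∫ x, g x = 2 / Real.exp 1 := by
    rw [hg, integral_const_mul, hI]
    field_simp
    norm_num
  have hflog : Integrable (fun x => f x * Real.log (f x)) := by
    refine hlog.mono' (hint.aestronglyMeasurable.mul
      (Real.measurable_log.comp_aemeasurable hint.aemeasurable).aestronglyMeasurable) ?_
    refine Filter.Eventually.of_forall fun x => ?_
    rw [Real.norm_eq_abs, abs_mul, abs_of_nonneg (hf x)]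
  have hL : 0 ≤ Real.log (2 * π) := Real.log_nonneg (by nlinarith [Real.pi_gt_three])
  have h3 : Integrable (fun x => (1 / 4) * (f x * ‖x‖ ^ 2)) := h2.const_mul _
  have h4 : Integrable (fun x => f x * (2 * Real.log (2 * π))) := hint.mul_const _
  have key : ∀ x, f x * max (Real.log (f x)) 0 ≤
      f x * Real.log (f x) + (1 / 4) * (f x * ‖x‖ ^ 2) + f x * (2 * Real.log (2 * π)) + g x := by
    intro x
    have hgx : 0 < g x := by simp only [hg]; positivity
    have h0 := hf x
    have hA : 0 ≤ f x * ‖x‖ ^ 2 := by positivity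
    have hB : 0 ≤ f x * Real.log (2 * π) := by positivity
    rcases le_total 0 (Real.log (f x)) with h | h
    · rw [max_eq_left h]; linarith
    · rw [max_eq_right h]
      rcases h0.eq_or_lt with h0 | h0
      · rw [← h0]; simp; exact hgx.le
      · have h5 := Real.log_le_sub_one_of_pos (div_pos hgx h0)
        rw [Real.log_div hgx.ne' h0.ne'] at h5
        have h6 : Real.log (g x) = -(Real.log (2 * π) + 1) + -(1 / 4) * ‖x‖ ^ 2 := by
          simp only [hg]
          rw [Real.log_mul (by positivity) (by positivity), Real.log_exp, one_div,
            Real.log_inv, Real.log_mul (by positivity) (by positivity), Real.log_exp]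
        rw [h6] at h5
        have h7 := mul_le_mul_of_nonneg_left h5 h0.le
        have h8 : f x * (g x / f x - 1) = g x - f x := by field_simp
        rw [h8] at h7
        nlinarith
  have hle := integral_mono_of_nonneg
    (Filter.Eventually.of_forall fun x => mul_nonneg (hf x) (le_max_right _ _))
    (((hflog.add h3).add h4).add hgint) (Filter.Eventually.of_forall key)
  refine hle.trans (le_of_eq ?_)
  have e1 := integral_add ((hflog.add h3).add h4) hgint
  have e2 := integral_add (hflog.add h3) h4
  have e3 := integral_add hflog h3
  simp only [Pi.add_apply] at e1 e2 e3 ⊢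
  rw [e1, e2, e3, hgI, integral_const_mul, integral_mul_const]
  ring
end
end

section
/- Every nonnegative integrable function g on ℝ² with mass M := ∫_{ℝ²} g dx and H⁺(g) := ∫_{ℝ²} g (log g)₊ dx < ∞ satisfies, for every ε ∈ (0,1) and every λ > 1: (1/(4π)) ∬_{{|x−y| ≤ ε}} g(x) g(y) (log|x−y|)₋ dx dy ≤ (λ/3) · M · ε^{3/2} + (1/(4π)) · (H⁺(g)/log λ) · (H⁺(g) + 2πε). -/
open MeasureTheory Real
noncomputable section

lemma conv_aux (f k : EuclideanSpace ℝ (Fin 2) → ℝ) (hf : Integrable f) (hk : Integrable k) :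
    Integrable (fun q : EuclideanSpace ℝ (Fin 2) × EuclideanSpace ℝ (Fin 2) => f q.2 * k (q.1 - q.2)) ∧
    ∫ q : EuclideanSpace ℝ (Fin 2) × EuclideanSpace ℝ (Fin 2), f q.2 * k (q.1 - q.2) = (∫ x, f x) * ∫ x, k x := by
  have h1 : Integrable (fun q : EuclideanSpace ℝ (Fin 2) × EuclideanSpace ℝ (Fin 2) => f q.2 * k (q.1 - q.2)) :=
    hf.convolution_integrand (ContinuousLinearMap.mul ℝ ℝ) hk
  refine ⟨h1, ?_⟩
  rw [Measure.volume_eq_prod, integral_prod_symm _ h1]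
  simp only [integral_const_mul]
  simp_rw [integral_sub_right_eq_self k]
  rw [integral_mul_const]

lemma ker_aux (s ε : ℝ) (hs : -2 < s) (hε : 0 < ε) :
    Integrable (fun x : EuclideanSpace ℝ (Fin 2) => if ‖x‖ ≤ ε then ‖x‖ ^ s else 0) ∧
    ∫ x : EuclideanSpace ℝ (Fin 2), (if ‖x‖ ≤ ε then ‖x‖ ^ s else 0) = 2 * π * (ε ^ (s + 2) / (s + 2)) := by
  have key : ∀ y ∈ Set.Ioi (0:ℝ), y ^ (2 - 1) • (if y ≤ ε then y ^ s else 0)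
      = Set.indicator (Set.Ioc 0 ε) (fun y => y ^ (s + 1)) y := by
    intro y hy
    have hy : 0 < y := hy
    by_cases h : y ≤ ε
    · rw [if_pos h, Set.indicator_of_mem (Set.mem_Ioc.2 ⟨hy, h⟩), rpow_add_one hy.ne']
      simp [mul_comm]
    · rw [if_neg h, Set.indicator_of_notMem (fun h' => h h'.2)]; simp
  constructor
  · have := (integrable_fun_norm_addHaar (volume : Measure (EuclideanSpace ℝ (Fin 2)))
      (f := fun y : ℝ => if y ≤ ε then y ^ s else 0))
    rw [this]
    simp only [finrank_euclideanSpace_fin]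
    rw [integrableOn_congr_fun key measurableSet_Ioi]
    apply Integrable.integrableOn
    rw [integrable_indicator_iff measurableSet_Ioc, ← intervalIntegrable_iff_integrableOn_Ioc_of_le hε.le]
    exact intervalIntegral.intervalIntegrable_rpow' (by linarith)
  · have := (integral_fun_norm_addHaar (volume : Measure (EuclideanSpace ℝ (Fin 2)))
      (fun y : ℝ => if y ≤ ε then y ^ s else 0))
    rw [this]
    simp only [finrank_euclideanSpace_fin]
    rw [setIntegral_congr_fun measurableSet_Ioi key, setIntegral_indicator measurableSet_Ioc,
      Set.inter_eq_right.2 Set.Ioc_subset_Ioi_self, ← intervalIntegral.integral_of_le hε.le,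
      integral_rpow (Or.inl (by linarith)), zero_rpow (by linarith)]
    rw [Measure.real, EuclideanSpace.volume_ball_fin_two]
    have : s + 1 + 1 = s + 2 := by ring
    rw [this]
    simp [mul_assoc, Real.pi_pos.le]

lemma neglog_le (u : ℝ) (hu : 0 ≤ u) : max (-Real.log u) 0 ≤ u ^ (-(1/2) : ℝ) := by
  apply max_le _ (by positivity)
  rcases hu.eq_or_lt with rfl | h
  · simp
  · have h1 := Real.add_one_le_exp (-(1/2) * log u)
    have h2 := Real.add_one_le_exp (-(1/2) * log u - 1)
    have h3 : rexp (-(1/2) * log u) = rexp (-(1/2) * log u - 1) * rexp 1 := by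
      rw [← Real.exp_add]; ring_nf
    rw [rpow_def_of_pos h, mul_comm (log u)]
    have h4 := Real.exp_one_gt_d9
    by_cases hl : -log u ≤ 0
    · exact hl.trans (exp_pos _).le
    · nlinarith

lemma young_aux (u r : ℝ) (hu : 0 ≤ u) (hr : 0 ≤ r) :
    u * max (-Real.log r) 0 ≤ u * max (Real.log u) 0 + r ^ (-1 : ℝ) := by
  rcases hr.eq_or_lt with rfl | hr
  · simp; positivity
  rcases hu.eq_or_lt with rfl | hu
  · simp; positivity
  have h0 : 0 < r ^ (-1 : ℝ) := by positivity
  rcases max_cases (-Real.log r) 0 with ⟨h, h'⟩ | ⟨h, h'⟩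
  · rw [h]
    have h1 := Real.add_one_le_exp (-Real.log r - Real.log u)
    rw [exp_sub, exp_log hu, exp_neg, exp_log hr, le_div_iff₀ hu] at h1
    rw [rpow_neg_one]
    have := mul_le_mul_of_nonneg_left (le_max_left (log u) 0) hu.le
    nlinarith
  · rw [h]; simp; positivity

theorem short_range_interaction_bound (g : EuclideanSpace ℝ (Fin 2) → ℝ)
    (hg : ∀ x, 0 ≤ g x) (hint : Integrable g)
    (hH : Integrable (fun x => g x * max (Real.log (g x)) 0))
    (ε : ℝ) (hε : ε ∈ Set.Ioo (0 : ℝ) 1) (lam : ℝ) (hlam : 1 < lam) :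
    (1 / (4 * π)) *
        ∫ q in {q : EuclideanSpace ℝ (Fin 2) × EuclideanSpace ℝ (Fin 2) |
            ‖q.1 - q.2‖ ≤ ε},
          g q.1 * g q.2 * max (-Real.log ‖q.1 - q.2‖) 0 ≤
      (lam / 3) * (∫ x, g x) * ε ^ ((3 : ℝ) / 2) +
        (1 / (4 * π)) * ((∫ x, g x * max (Real.log (g x)) 0) / Real.log lam) *
          ((∫ x, g x * max (Real.log (g x)) 0) + 2 * π * ε) := by
  obtain ⟨hε0, hε1⟩ := hε
  have hl := Real.log_pos hlam
  obtain ⟨k1, i1⟩ := ker_aux (-(1/2)) ε (by norm_num) hε0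
  obtain ⟨k2, i2⟩ := ker_aux (-1) ε (by norm_num) hε0
  set K1 : EuclideanSpace ℝ (Fin 2) → ℝ := fun x => if ‖x‖ ≤ ε then ‖x‖ ^ (-(1/2) : ℝ) else 0 with hK1
  set K2 : EuclideanSpace ℝ (Fin 2) → ℝ := fun x => if ‖x‖ ≤ ε then ‖x‖ ^ (-1 : ℝ) else 0 with hK2
  set G : EuclideanSpace ℝ (Fin 2) → ℝ := fun x => g x * max (Real.log (g x)) 0 with hG
  have hG0 : ∀ x, 0 ≤ G x := fun x => mul_nonneg (hg x) (le_max_right _ _)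
  obtain ⟨c1, d1⟩ := conv_aux g K1 hint k1
  obtain ⟨c2, d2⟩ := conv_aux G K2 hH k2
  have c3 : Integrable (fun q : EuclideanSpace ℝ (Fin 2) × EuclideanSpace ℝ (Fin 2) => G q.1 * K2 (q.2 - q.1)) :=
    c2.swap
  have d3 : ∫ q : EuclideanSpace ℝ (Fin 2) × EuclideanSpace ℝ (Fin 2), G q.1 * K2 (q.2 - q.1) =
      (∫ x, G x) * ∫ x, K2 x := by
    rw [← d2]
    exact integral_prod_swap (fun q : EuclideanSpace ℝ (Fin 2) × EuclideanSpace ℝ (Fin 2) => G q.2 * K2 (q.1 - q.2))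
  have c4 : Integrable (fun q : EuclideanSpace ℝ (Fin 2) × EuclideanSpace ℝ (Fin 2) => G q.1 * G q.2) :=
    hH.mul_prod hH
  have d4 : ∫ q : EuclideanSpace ℝ (Fin 2) × EuclideanSpace ℝ (Fin 2), G q.1 * G q.2 =
      (∫ x, G x) * ∫ x, G x := integral_prod_mul G G
  have hS : MeasurableSet {q : EuclideanSpace ℝ (Fin 2) × EuclideanSpace ℝ (Fin 2) | ‖q.1 - q.2‖ ≤ ε} :=
    measurableSet_le (by fun_prop) (by fun_prop)
  have main : ∫ q in {q : EuclideanSpace ℝ (Fin 2) × EuclideanSpace ℝ (Fin 2) | ‖q.1 - q.2‖ ≤ ε},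
          g q.1 * g q.2 * max (-Real.log ‖q.1 - q.2‖) 0 ≤
      ∫ q : EuclideanSpace ℝ (Fin 2) × EuclideanSpace ℝ (Fin 2), (lam * (g q.2 * K1 (q.1 - q.2)) +
        (Real.log lam)⁻¹ * (G q.1 * G q.2 + G q.1 * K2 (q.2 - q.1))) := by
    rw [← integral_indicator hS]
    apply integral_mono_of_nonneg
    · refine Filter.Eventually.of_forall fun q => ?_
      exact Set.indicator_nonneg (fun q _ => mul_nonneg (mul_nonneg (hg _) (hg _)) (le_max_right _ _)) q
    · exact (c1.const_mul lam).add ((c4.add c3).const_mul _)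
    · refine Filter.Eventually.of_forall fun q => ?_
      have hK1n : 0 ≤ K1 (q.1 - q.2) := by simp only [hK1]; split_ifs <;> positivity
      have hK2n : 0 ≤ K2 (q.2 - q.1) := by simp only [hK2]; split_ifs <;> positivity
      have hA : 0 ≤ lam * (g q.2 * K1 (q.1 - q.2)) :=
        mul_nonneg (by linarith) (mul_nonneg (hg _) hK1n)
      have hB : 0 ≤ (Real.log lam)⁻¹ * (G q.1 * G q.2 + G q.1 * K2 (q.2 - q.1)) :=
        mul_nonneg (by positivity) (add_nonneg (mul_nonneg (hG0 _) (hG0 _)) (mul_nonneg (hG0 _) hK2n))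
      by_cases hq : ‖q.1 - q.2‖ ≤ ε
      · simp only
        rw [Set.indicator_of_mem (by exact hq)]
        have e1 : K1 (q.1 - q.2) = ‖q.1 - q.2‖ ^ (-(1/2) : ℝ) := if_pos hq
        have e2 : K2 (q.2 - q.1) = ‖q.1 - q.2‖ ^ (-1 : ℝ) := by
          simp only [hK2]; rw [norm_sub_rev, if_pos hq]
        have b1 := neglog_le ‖q.1 - q.2‖ (norm_nonneg _)
        have b2 := young_aux (g q.2) ‖q.1 - q.2‖ (hg _) (norm_nonneg _)
        rw [← e1] at b1
        rw [← e2] at b2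
        by_cases hx : g q.1 ≤ lam
        · have : g q.1 * g q.2 * max (-Real.log ‖q.1 - q.2‖) 0 ≤ lam * (g q.2 * K1 (q.1 - q.2)) := by
            rw [mul_assoc]
            exact mul_le_mul hx (mul_le_mul_of_nonneg_left b1 (hg _))
              (mul_nonneg (hg _) (le_max_right _ _)) (by linarith)
          linarith
        · push Not at hx
          have h5 : g q.1 ≤ (Real.log lam)⁻¹ * G q.1 := by
            rw [inv_mul_eq_div, le_div_iff₀ hl]
            exact mul_le_mul_of_nonneg_left
              ((Real.log_le_log (by linarith) hx.le).trans (le_max_left _ _)) (hg _)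
          have : g q.1 * g q.2 * max (-Real.log ‖q.1 - q.2‖) 0 ≤
              ((Real.log lam)⁻¹ * G q.1) * (G q.2 + K2 (q.2 - q.1)) := by
            rw [mul_assoc]
            exact mul_le_mul h5 b2
              (mul_nonneg (hg _) (le_max_right _ _)) (mul_nonneg (by positivity) (hG0 _))
          linarith
      · simp only
        rw [Set.indicator_of_notMem (by exact hq)]
        linarith
  have c5 : Integrable (fun q : EuclideanSpace ℝ (Fin 2) × EuclideanSpace ℝ (Fin 2) =>
      (Real.log lam)⁻¹ * (G q.1 * G q.2 + G q.1 * K2 (q.2 - q.1))) := (c4.add c3).const_mul _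
  rw [integral_add (c1.const_mul lam) c5, integral_const_mul,
    integral_const_mul] at main
  rw [integral_add c4 c3, d1, d3, d4, i1, i2] at main
  have hp := Real.pi_pos
  have := mul_le_mul_of_nonneg_left main (show 0 ≤ 1 / (4 * π) by positivity)
  refine this.trans (le_of_eq ?_)
  norm_num
  field_simp
  ring
end
end

section
/- Let c > 0, C ≥ 0 and T ∈ (0, ∞]. Every differentiable function u : (0, T) → [0, ∞) satisfying u'(t) + c · u(t)² ≤ C for all t ∈ (0, T) satisfies u(t) ≤ 1/(c t) + √(C/c) for all t ∈ (0, T). -/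
open Real

noncomputable section

/-- ODE comparison: if `c > 0`, `C ≥ 0`, `T ∈ (0, ∞]` and `u : (0,T) → [0,∞)` is
differentiable with `u' + c u² ≤ C` on `(0,T)`, then `u(t) ≤ 1/(ct) + √(C/c)`
for every `t ∈ (0,T)`. -/
theorem ode_smoothing_bound (c C : ℝ) (hc : 0 < c) (hC : 0 ≤ C)
    (T : EReal) (hT : 0 < T) (u u' : ℝ → ℝ)
    (hpos : ∀ t : ℝ, 0 < t → (t : EReal) < T → 0 ≤ u t)
    (hderiv : ∀ t : ℝ, 0 < t → (t : EReal) < T → HasDerivAt u (u' t) t)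
    (hineq : ∀ t : ℝ, 0 < t → (t : EReal) < T → u' t + c * u t ^ 2 ≤ C) :
    ∀ t : ℝ, 0 < t → (t : EReal) < T → u t ≤ 1 / (c * t) + Real.sqrt (C / c) := by
  intro t ht htT
  set s := Real.sqrt (C / c) with hs
  have hs0 : 0 ≤ s := Real.sqrt_nonneg _
  have hCs : C = c * s ^ 2 := by
    rw [hs, Real.sq_sqrt (by positivity)]
    field_simp
  have hlt : ∀ x : ℝ, x ≤ t → (x : EReal) < T := fun x hx =>
    lt_of_le_of_lt (EReal.coe_le_coe_iff.2 hx) htT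
  have key : ∀ ε : ℝ, 0 < ε → ε < t → u t ≤ 1 / (c * (t - ε)) + (s + ε) := by
    intro ε hε hεt
    have hcont : ContinuousOn u (Set.Icc ε t) := fun x hx =>
      (hderiv x (lt_of_lt_of_le hε hx.1) (hlt x hx.2)).continuousAt.continuousWithinAt
    obtain ⟨M, hM⟩ := isCompact_Icc.exists_bound_of_continuousOn hcont
    have hM1 : 0 < |M| + 1 := by positivity
    set δ := min (t - ε) (1 / (c * (|M| + 1))) with hδ
    have hδ0 : 0 < δ := lt_min (by linarith) (by positivity)
    have hδ1 : δ ≤ t - ε := min_le_left _ _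
    have hδ2 : δ ≤ 1 / (c * (|M| + 1)) := min_le_right _ _
    have hstart : u (ε + δ) ≤ 1 / (c * (ε + δ - ε)) + (s + ε) := by
      have h1 := hM (ε + δ) ⟨by linarith, by linarith⟩
      have h2 : |M| + 1 ≤ 1 / (c * (ε + δ - ε)) := by
        rw [add_sub_cancel_left, le_div_iff₀ (by positivity)]
        rw [le_div_iff₀ (by positivity)] at hδ2
        linarith
      rw [Real.norm_eq_abs] at h1
      linarith [le_abs_self (u (ε + δ)), le_abs_self M]
    have hB : ∀ x : ℝ, ε < x → HasDerivAt (fun x => 1 / (c * (x - ε)) + (s + ε))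
        (-(1 / (c * (x - ε) ^ 2))) x := by
      intro x hx
      have hx0 : x - ε ≠ 0 := by linarith
      have h := ((((hasDerivAt_id x).sub_const ε).const_mul c).fun_inv
        (mul_ne_zero hc.ne' hx0)).add_const (s + ε)
      simp only [one_div]
      refine h.congr_deriv ?_
      simp only [id]
      field_simp
    refine image_le_of_deriv_right_lt_deriv_boundary' (f := u) (f' := u') (a := ε + δ) (b := t)
      (B := fun x => 1 / (c * (x - ε)) + (s + ε)) (B' := fun x => -(1 / (c * (x - ε) ^ 2)))
      (hcont.mono (Set.Icc_subset_Icc_left (by linarith))) ?_ hstart ?_ ?_ ?_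
      ⟨by linarith, le_refl t⟩
    · intro x hx
      exact (hderiv x (by linarith [hx.1]) (hlt x hx.2.le)).hasDerivWithinAt
    · intro x hx
      exact (hB x (by linarith [hx.1])).continuousAt.continuousWithinAt
    · intro x hx
      exact (hB x (by linarith [hx.1])).hasDerivWithinAt
    · intro x hx hux
      have hxε : 0 < x - ε := by linarith [hx.1]
      have h := hineq x (by linarith [hx.1]) (hlt x hx.2.le)
      have hp : 0 < 1 / (c * (x - ε)) := by positivity
      have he : 1 / (c * (x - ε) ^ 2) = c * (1 / (c * (x - ε))) ^ 2 := by
        field_simp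
      rw [he]
      rw [hux, hCs] at h
      generalize 1 / (c * (x - ε)) = p at *
      have h3 : 0 < c * (2 * p * (s + ε) + (2 * s * ε + ε ^ 2)) := by positivity
      nlinarith
  have hlim : Filter.Tendsto (fun ε : ℝ => 1 / (c * (t - ε)) + (s + ε))
      (nhdsWithin 0 (Set.Ioi 0)) (nhds (1 / (c * t) + s)) := by
    have : ContinuousAt (fun ε : ℝ => 1 / (c * (t - ε)) + (s + ε)) 0 := by
      have h0 : c * (t - 0) ≠ 0 := by simp [hc.ne', ht.ne']
      fun_prop (disch := assumption)
    have h := this.tendsto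
    simp only [sub_zero, add_zero] at h
    exact h.mono_left nhdsWithin_le_nhds
  refine ge_of_tendsto hlim ?_
  filter_upwards [Ioo_mem_nhdsGT ht] with ε hε
  exact key ε hε.1 hε.2
end
end

section
/- Let f be a nonnegative measurable function on ℝ² with ∫_{ℝ²} f dx = M < ∞ and B := ∫_{ℝ²} f · (2 + (log f)₊) dx < ∞. For every t ∈ (0, 1) and K ≥ 0 such that t ∫_{ℝ²} f² dx ≤ K, one has t^{1/4} ‖f‖_{L^{4/3}(ℝ²)} ≤ B^{1/2} · (M + K)^{1/4} / (2 + log(1/t))^{1/2}. -/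
open MeasureTheory Real

noncomputable section

lemma l43_pointwise (y t : ℝ) (hy : 0 ≤ y) (ht0 : 0 < t) (ht1 : t < 1) :
    y ^ 2 / (2 + max (Real.log y) 0) ^ 2 ≤
      (y + t * y ^ 2) / (t * (2 + Real.log (1 / t)) ^ 2) := by
  have hl : 0 < Real.log (1 / t) := Real.log_pos (by rw [lt_div_iff₀ ht0]; linarith)
  have hel : Real.exp (Real.log (1 / t)) = 1 / t := Real.exp_log (by positivity)
  set l := Real.log (1 / t) with hldef
  have hs : 0 ≤ max (Real.log y) 0 := le_max_right _ _
  have hys : y ≤ Real.exp (max (Real.log y) 0) := by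
    rcases hy.eq_or_lt with h | h
    · rw [← h]; positivity
    · calc y = Real.exp (Real.log y) := (Real.exp_log h).symm
        _ ≤ _ := Real.exp_le_exp.mpr (le_max_left _ _)
  have hcase : max (Real.log y) 0 ≤ l ∨ l ≤ Real.log y := by
    rcases le_total (Real.log y) l with h | h
    · exact Or.inl (max_le h hl.le)
    · exact Or.inr h
  have hmax : Real.log y ≤ max (Real.log y) 0 := le_max_left _ _
  generalize max (Real.log y) 0 = s at *
  rw [div_le_div_iff₀ (by positivity) (by positivity)]
  rcases hcase with h | h
  · have h1 : (2 + l) ≤ (2 + s) * Real.exp ((l - s) / 2) := by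
      have := Real.add_one_le_exp ((l - s) / 2)
      nlinarith [mul_le_mul_of_nonneg_left this (by linarith : 0 ≤ 2 + s), mul_nonneg hs (sub_nonneg.mpr h)]
    have h2 : (2 + l) ^ 2 ≤ (2 + s) ^ 2 * Real.exp (l - s) := by
      calc (2 + l) ^ 2 ≤ ((2 + s) * Real.exp ((l - s) / 2)) ^ 2 := by gcongr
        _ = _ := by rw [mul_pow, ← Real.exp_nat_mul]; congr 2; push_cast; ring
    have h3 : y * Real.exp (l - s) * t ≤ 1 := by
      calc y * Real.exp (l - s) * t ≤ Real.exp s * Real.exp (l - s) * t := by gcongr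
        _ = Real.exp l * t := by rw [← Real.exp_add]; congr 2; ring
        _ = 1 := by rw [hel]; field_simp
    calc y ^ 2 * (t * (2 + l) ^ 2) ≤ y ^ 2 * (t * ((2 + s) ^ 2 * Real.exp (l - s))) := by gcongr
      _ = y * (2 + s) ^ 2 * (y * Real.exp (l - s) * t) := by ring
      _ ≤ y * (2 + s) ^ 2 * 1 := by gcongr
      _ ≤ (y + t * y ^ 2) * (2 + s) ^ 2 := by
        rw [mul_one]; gcongr; nlinarith [mul_nonneg ht0.le (sq_nonneg y)]
  · calc y ^ 2 * (t * (2 + l) ^ 2) ≤ y ^ 2 * (t * (2 + s) ^ 2) := by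
          gcongr; linarith
      _ = (t * y ^ 2) * (2 + s) ^ 2 := by ring
      _ ≤ _ := by gcongr; linarith

lemma l43_factor (y w : ℝ) (hy : 0 ≤ y) (hw : 0 < w) :
    y ^ ((4 : ℝ) / 3) = (y * w) ^ ((2 : ℝ) / 3) * (y ^ 2 / w ^ 2) ^ ((1 : ℝ) / 3) := by
  rw [Real.mul_rpow hy hw.le, ← div_pow, ← Real.rpow_natCast, ← Real.rpow_mul (by positivity),
    Real.div_rpow hy hw.le]
  norm_num
  have : w ^ ((2 : ℝ) / 3) ≠ 0 := by positivity
  field_simp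
  rcases hy.eq_or_lt with h | h
  · rw [← h, Real.zero_rpow (by norm_num), Real.zero_rpow (by norm_num)]; norm_num
  · rw [← Real.rpow_natCast, ← Real.rpow_mul hy]; norm_num

/-- Interpolation estimate driving the `L^{4/3}` uniqueness argument: if `f ≥ 0` is
measurable on `ℝ²` with mass `M = ∫ f`, `B = ∫ f (2 + (log f)₊) < ∞` and
`t ∫ f² ≤ K` for some `t ∈ (0,1)` and `K ≥ 0`, then
`t^{1/4} ‖f‖_{L^{4/3}} ≤ B^{1/2} (M + K)^{1/4} / (2 + log(1/t))^{1/2}`. -/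
theorem l43_smallness (f : EuclideanSpace ℝ (Fin 2) → ℝ)
    (hf : ∀ x, 0 ≤ f x) (hmeas : Measurable f) (hint : Integrable f)
    (hB : Integrable (fun x => f x * (2 + max (Real.log (f x)) 0)))
    (hsq : Integrable (fun x => f x ^ 2))
    (t K : ℝ) (ht : t ∈ Set.Ioo (0 : ℝ) 1) (hK : 0 ≤ K)
    (htK : t * ∫ x, f x ^ 2 ≤ K) :
    ENNReal.ofReal (t ^ ((1 : ℝ) / 4)) * eLpNorm f (4 / 3) volume ≤
      ENNReal.ofReal
        ((∫ x, f x * (2 + max (Real.log (f x)) 0)) ^ ((1 : ℝ) / 2) *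
          ((∫ x, f x) + K) ^ ((1 : ℝ) / 4) /
          (2 + Real.log (1 / t)) ^ ((1 : ℝ) / 2)) := by
  obtain ⟨ht0, ht1⟩ := ht
  have hl : 0 < Real.log (1 / t) := Real.log_pos (by rw [lt_div_iff₀ ht0]; linarith)
  have hpt := fun x => l43_pointwise (f x) t (hf x) ht0 ht1
  set l := Real.log (1 / t) with hldef
  set w : EuclideanSpace ℝ (Fin 2) → ℝ := fun x => 2 + max (Real.log (f x)) 0 with hwdef
  have hw : ∀ x, 0 < w x := fun x => by
    have : 0 ≤ max (Real.log (f x)) 0 := le_max_right _ _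
    simp only [hwdef]; linarith
  have hwm : Measurable w := by
    simp only [hwdef]
    exact measurable_const.add ((Real.measurable_log.comp hmeas).max measurable_const)
  change Integrable (fun x => f x * w x) at hB
  change ∀ x, f x ^ 2 / w x ^ 2 ≤ _ at hpt
  change _ ≤ ENNReal.ofReal ((∫ x, f x * w x) ^ ((1 : ℝ) / 2) * _ / _)
  set M := ∫ x, f x with hM
  set B := ∫ x, f x * w x with hBdef
  have hM0 : 0 ≤ M := integral_nonneg hf
  have hB0 : 0 ≤ B := integral_nonneg fun x => mul_nonneg (hf x) (hw x).le
  have hA : ∫⁻ x, ENNReal.ofReal (f x * w x) = ENNReal.ofReal B :=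
    (ofReal_integral_eq_lintegral_ofReal hB
      (Filter.Eventually.of_forall fun x => mul_nonneg (hf x) (hw x).le)).symm
  have hC : ∫⁻ x, ENNReal.ofReal (f x ^ 2 / w x ^ 2) ≤
      ENNReal.ofReal ((M + K) / (t * (2 + l) ^ 2)) := by
    have hi : Integrable (fun x => (f x + t * f x ^ 2) / (t * (2 + l) ^ 2)) :=
      (hint.add (hsq.const_mul t)).div_const _
    calc _ ≤ ∫⁻ x, ENNReal.ofReal ((f x + t * f x ^ 2) / (t * (2 + l) ^ 2)) :=
          lintegral_mono fun x => ENNReal.ofReal_le_ofReal (hpt x)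
      _ = ENNReal.ofReal (∫ x, (f x + t * f x ^ 2) / (t * (2 + l) ^ 2)) :=
          (ofReal_integral_eq_lintegral_ofReal hi (Filter.Eventually.of_forall fun x => by
            have := hf x
            show 0 ≤ (f x + t * f x ^ 2) / (t * (2 + l) ^ 2)
            positivity)).symm
      _ ≤ _ := by
          apply ENNReal.ofReal_le_ofReal
          rw [integral_div, integral_add hint (hsq.const_mul t), integral_const_mul]
          gcongr
  have hH : ∫⁻ x, ‖f x‖ₑ ^ ((4 : ℝ) / 3) ≤
      ENNReal.ofReal (B ^ ((2 : ℝ) / 3) * ((M + K) / (t * (2 + l) ^ 2)) ^ ((1 : ℝ) / 3)) := by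
    have hpq : ((3 : ℝ) / 2).HolderConjugate 3 := by
      rw [Real.holderConjugate_iff]; norm_num
    have := ENNReal.lintegral_mul_le_Lp_mul_Lq volume hpq
      (f := fun x => ENNReal.ofReal (f x * w x) ^ ((2 : ℝ) / 3))
      (g := fun x => ENNReal.ofReal (f x ^ 2 / w x ^ 2) ^ ((1 : ℝ) / 3))
      (by fun_prop) (by fun_prop)
    simp only [← ENNReal.rpow_mul, Pi.mul_apply] at this
    norm_num at this
    rw [hA] at this
    calc _ = ∫⁻ x, ENNReal.ofReal (f x * w x) ^ ((2 : ℝ) / 3) *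
          ENNReal.ofReal (f x ^ 2 / w x ^ 2) ^ ((1 : ℝ) / 3) := by
          apply lintegral_congr
          intro x
          have h1 := hf x
          have h2 := hw x
          rw [Real.enorm_of_nonneg h1, ENNReal.ofReal_rpow_of_nonneg h1 (by norm_num),
            ENNReal.ofReal_rpow_of_nonneg (by positivity) (by norm_num),
            ENNReal.ofReal_rpow_of_nonneg (by positivity) (by norm_num),
            ← ENNReal.ofReal_mul (by positivity), l43_factor _ _ h1 h2]
      _ ≤ _ := this
      _ ≤ ENNReal.ofReal B ^ ((2 : ℝ) / 3) *
          ENNReal.ofReal ((M + K) / (t * (2 + l) ^ 2)) ^ ((1 : ℝ) / 3) := by gcongr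
      _ = _ := by
          rw [ENNReal.ofReal_rpow_of_nonneg (by positivity) (by norm_num),
            ENNReal.ofReal_rpow_of_nonneg (by positivity) (by norm_num),
            ← ENNReal.ofReal_mul (by positivity)]
  have h43 : ((4 : ENNReal) / 3).toReal = 4 / 3 := by simp
  rw [eLpNorm_eq_lintegral_rpow_enorm_toReal (by simp) (ENNReal.div_ne_top (by simp) (by simp)),
    h43]
  calc _ ≤ ENNReal.ofReal (t ^ ((1 : ℝ) / 4)) * ENNReal.ofReal (B ^ ((2 : ℝ) / 3) *
        ((M + K) / (t * (2 + l) ^ 2)) ^ ((1 : ℝ) / 3)) ^ ((1 : ℝ) / (4 / 3)) := by gcongr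
    _ = _ := by
      rw [ENNReal.ofReal_rpow_of_nonneg (by positivity) (by norm_num),
        ← ENNReal.ofReal_mul (by positivity)]
      congr 1
      have e : ((2 + l) ^ 2) ^ ((1 : ℝ) / 4) = (2 + l) ^ ((1 : ℝ) / 2) := by
        rw [← Real.rpow_natCast, ← Real.rpow_mul (by positivity)]; norm_num
      rw [Real.mul_rpow (by positivity) (by positivity), ← Real.rpow_mul hB0,
        ← Real.rpow_mul (by positivity),
        show (2 : ℝ) / 3 * (1 / (4 / 3)) = 1 / 2 by norm_num,
        show (1 : ℝ) / 3 * (1 / (4 / 3)) = 1 / 4 by norm_num,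
        Real.div_rpow (by positivity) (by positivity),
        Real.mul_rpow ht0.le (by positivity), e]
      have : t ^ ((1 : ℝ) / 4) ≠ 0 := by positivity
      field_simp
end
end
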